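/- arXiv:2603.16454 — 2 statements merged into one kernel-verified Lean document; each statement's English description precedes it below -/
import Mathlib

section
/- For every C > 0 there exists N such that the following holds for all n ≥ N, all integers k with C(n,k)·2^{−C(k,2)} ∈ [n^{5/6}, n^{6/5}], and all integers i with 0 ≤ i ≤ C·log log n. Let ℬ₂ be the event that there exist a (k+1)-element vertex set S inducing exactly i or exactly i+1 edges and an edge e induced by S such that the number of independent k-sets covering e is at most (3/4)^k·E[Y_k]/2, where E[Y_k] = C(n,k)·2^{−C(k,2)}. Let ℬ₃ be the event that there exist such an S and edge e of S and two distinct independent k-sets T₁ ≠ T₂ both covering e with T₁ ∩ T₂ ≠ ∅. Then P(ℬ₂) ≤ n^{−1/100} and P(ℬ₃) ≤ n^{−1/100} in G_{n,1/2}. -/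
open scoped Classical

/-- Probability of an event under the uniform measure on simple graphs on `Fin n`
(equivalently, `G_{n,1/2}`). -/
noncomputable def grPr (n : ℕ) (S : Set (SimpleGraph (Fin n))) : ℝ :=
  ((PMF.uniformOfFintype (SimpleGraph (Fin n))).toOuterMeasure S).toReal

/-- Number of edges of `G` with both endpoints in `s`. -/
noncomputable def edgesIn {n : ℕ} (G : SimpleGraph (Fin n)) (s : Finset (Fin n)) : ℕ :=
  {e ∈ G.edgeSet | ∀ v ∈ e, v ∈ s}.ncard

/-- `E[Y_k] = C(n,k)·2^{-C(k,2)}`. -/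
noncomputable def expY (n k : ℕ) : ℝ := (n.choose k : ℝ) / 2 ^ (k.choose 2)

/-- A set `T` (with both endpoints `u, v` of an edge outside `T`) covers the edge `uv`
if no vertex of `T` is adjacent to both `u` and `v`. -/
def Covers {n : ℕ} (G : SimpleGraph (Fin n)) (T : Finset (Fin n)) (u v : Fin n) : Prop :=
  u ∉ T ∧ v ∉ T ∧ ∀ w ∈ T, ¬(G.Adj w u ∧ G.Adj w v)

/-- The number of independent `k`-sets covering the edge `uv`. -/
noncomputable def numCovers (n k : ℕ) (G : SimpleGraph (Fin n)) (u v : Fin n) : ℕ :=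
  {T : Finset (Fin n) | T.card = k ∧ edgesIn G T = 0 ∧ Covers G T u v}.ncard

open Finset

/-- Expectation of a random variable on `G_{n,1/2}`. -/
noncomputable def ex {n : ℕ} (f : SimpleGraph (Fin n) → ℝ) : ℝ :=
  (∑ G, f G) / (Fintype.card (SimpleGraph (Fin n)) : ℝ)

section Expectation

variable {n : ℕ}

lemma card_graphs_pos : (0 : ℝ) < (Fintype.card (SimpleGraph (Fin n)) : ℝ) := by
  exact_mod_cast Fintype.card_pos

lemma ex_mono {f g : SimpleGraph (Fin n) → ℝ} (h : ∀ G, f G ≤ g G) : ex f ≤ ex g :=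
  div_le_div_of_nonneg_right (Finset.sum_le_sum fun G _ => h G) card_graphs_pos.le

lemma ex_nonneg {f : SimpleGraph (Fin n) → ℝ} (h : ∀ G, 0 ≤ f G) : 0 ≤ ex f :=
  div_nonneg (Finset.sum_nonneg fun G _ => h G) card_graphs_pos.le

lemma ex_const (c : ℝ) : ex (fun _ : SimpleGraph (Fin n) => c) = c := by
  have := (card_graphs_pos (n := n)).ne'
  simp only [ex, Finset.sum_const, nsmul_eq_mul, Finset.card_univ]
  field_simp

lemma ex_add (f g : SimpleGraph (Fin n) → ℝ) : ex (fun G => f G + g G) = ex f + ex g := by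
  simp only [ex, Finset.sum_add_distrib, add_div]

lemma ex_const_mul (c : ℝ) (f : SimpleGraph (Fin n) → ℝ) :
    ex (fun G => c * f G) = c * ex f := by
  simp only [ex, ← Finset.mul_sum, mul_div_assoc]

lemma ex_sum {ι : Type*} (s : Finset ι) (f : ι → SimpleGraph (Fin n) → ℝ) :
    ex (fun G => ∑ i ∈ s, f i G) = ∑ i ∈ s, ex (f i) := by
  simp only [ex, Finset.sum_comm (s := Finset.univ) (t := s), Finset.sum_div]

lemma grPr_eq_ex (A : Set (SimpleGraph (Fin n))) :
    grPr n A = ex (fun G => if G ∈ A then (1 : ℝ) else 0) := by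
  rw [grPr, PMF.toOuterMeasure_uniformOfFintype_apply, ENNReal.toReal_div]
  simp [ex, Fintype.card_subtype]

lemma grPr_le_ex {A : Set (SimpleGraph (Fin n))} {f : SimpleGraph (Fin n) → ℝ}
    (h0 : ∀ G, 0 ≤ f G) (h1 : ∀ G ∈ A, 1 ≤ f G) : grPr n A ≤ ex f := by
  rw [grPr_eq_ex]
  refine ex_mono fun G => ?_
  split_ifs with h
  exacts [h1 G h, h0 G]

/-- `f` only depends on which elements of `D` are edges. -/
def DetBy {α : Type*} (f : SimpleGraph (Fin n) → α) (D : Set (Sym2 (Fin n))) : Prop :=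
  ∀ G H : SimpleGraph (Fin n), (∀ e ∈ D, e ∈ G.edgeSet ↔ e ∈ H.edgeSet) → f G = f H

lemma DetBy.mono {α : Type*} {f : SimpleGraph (Fin n) → α} {D D' : Set (Sym2 (Fin n))}
    (h : DetBy f D) (hD : D ⊆ D') : DetBy f D' :=
  fun G H hGH => h G H fun e he => hGH e (hD he)

lemma DetBy.comp {α β : Type*} {f : SimpleGraph (Fin n) → α} {D : Set (Sym2 (Fin n))}
    (h : DetBy f D) (φ : α → β) : DetBy (fun G => φ (f G)) D :=
  fun G H hGH => congrArg φ (h G H hGH)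

/-- The graph agreeing with `G` on `D` and with `H` off `D`. -/
def mixGraph (D : Set (Sym2 (Fin n))) (G H : SimpleGraph (Fin n)) : SimpleGraph (Fin n) :=
  SimpleGraph.fromEdgeSet ((G.edgeSet ∩ D) ∪ (H.edgeSet \ D))

lemma mem_mixGraph {D : Set (Sym2 (Fin n))} {G H : SimpleGraph (Fin n)} {e : Sym2 (Fin n)} :
    e ∈ (mixGraph D G H).edgeSet ↔ (e ∈ D ∧ e ∈ G.edgeSet) ∨ (e ∉ D ∧ e ∈ H.edgeSet) := by
  have h1 : e ∈ G.edgeSet → ¬ e.IsDiag := G.not_isDiag_of_mem_edgeSet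
  have h2 : e ∈ H.edgeSet → ¬ e.IsDiag := H.not_isDiag_of_mem_edgeSet
  rw [mixGraph, SimpleGraph.edgeSet_fromEdgeSet]
  simp only [Set.mem_sdiff, Set.mem_union, Set.mem_inter_iff, Sym2.mem_diagSet]
  tauto

lemma mixGraph_mixGraph (D : Set (Sym2 (Fin n))) (G H : SimpleGraph (Fin n)) :
    mixGraph D (mixGraph D G H) (mixGraph D H G) = G := by
  apply SimpleGraph.edgeSet_injective
  ext e
  simp only [mem_mixGraph]
  tauto

lemma ex_mul {f g : SimpleGraph (Fin n) → ℝ} {D D' : Set (Sym2 (Fin n))} (hf : DetBy f D)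
    (hg : DetBy g D') (hD : Disjoint D D') : ex (fun G => f G * g G) = ex f * ex g := by
  have key : ∑ p : SimpleGraph (Fin n) × SimpleGraph (Fin n), f p.1 * g p.1 =
      ∑ p : SimpleGraph (Fin n) × SimpleGraph (Fin n), f p.1 * g p.2 := by
    refine Finset.sum_bij' (fun p _ => (mixGraph D p.1 p.2, mixGraph D p.2 p.1))
      (fun p _ => (mixGraph D p.1 p.2, mixGraph D p.2 p.1)) (by simp) (by simp)
      (fun p _ => by simp [mixGraph_mixGraph]) (fun p _ => by simp [mixGraph_mixGraph]) ?_
    intro p _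
    congr 1
    · refine hf _ _ fun e he => ?_
      rw [mem_mixGraph]; tauto
    · refine hg _ _ fun e he => ?_
      have : e ∉ D := fun h => Set.disjoint_left.1 hD h he
      rw [mem_mixGraph]; tauto
  rw [Fintype.sum_prod_type, Fintype.sum_prod_type] at key
  simp only [Finset.sum_const, nsmul_eq_mul, ← Finset.mul_sum, ← Finset.sum_mul,
    Finset.card_univ] at key
  have := (card_graphs_pos (n := n)).ne'
  simp only [ex]
  field_simp
  linarith

lemma detBy_prod {ι : Type*} (s : Finset ι) {f : ι → SimpleGraph (Fin n) → ℝ}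
    {D : ι → Set (Sym2 (Fin n))} (hf : ∀ i ∈ s, DetBy (f i) (D i)) :
    DetBy (fun G => ∏ i ∈ s, f i G) (⋃ i ∈ s, D i) := by
  intro G H h
  refine Finset.prod_congr rfl fun i hi => hf i hi G H fun e he => h e ?_
  simp only [Set.mem_iUnion]
  exact ⟨i, hi, he⟩

lemma ex_prod {ι : Type*} (s : Finset ι) {f : ι → SimpleGraph (Fin n) → ℝ}
    {D : ι → Set (Sym2 (Fin n))} (hf : ∀ i ∈ s, DetBy (f i) (D i))
    (hD : ∀ i ∈ s, ∀ j ∈ s, i ≠ j → Disjoint (D i) (D j)) :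
    ex (fun G => ∏ i ∈ s, f i G) = ∏ i ∈ s, ex (f i) := by
  induction s using Finset.induction_on with
  | empty => simp [ex_const]
  | insert a s ha ih =>
    have hf' : ∀ i ∈ s, DetBy (f i) (D i) := fun i hi => hf i (mem_insert_of_mem hi)
    simp only [Finset.prod_insert ha]
    rw [ex_mul (hf a (mem_insert_self _ _)) (detBy_prod s hf'),
      ih hf' fun i hi j hj => hD i (mem_insert_of_mem hi) j (mem_insert_of_mem hj)]
    rw [Set.disjoint_iUnion₂_right]
    exact fun i hi => hD a (mem_insert_self _ _) i (mem_insert_of_mem hi)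
      (fun h => ha (h ▸ hi))

lemma detBy_edge {α : Type*} (e : Sym2 (Fin n)) (a b : α) :
    DetBy (fun G => if e ∈ G.edgeSet then a else b) {e} := by
  intro G H h
  simp only [h e rfl]

lemma ex_edge {e : Sym2 (Fin n)} (he : ¬ e.IsDiag) (a b : ℝ) :
    ex (fun G => if e ∈ G.edgeSet then a else b) = (a + b) / 2 := by
  have mem (G : SimpleGraph (Fin n)) (x : Sym2 (Fin n)) :
      x ∈ (SimpleGraph.fromEdgeSet (symmDiff G.edgeSet {e})).edgeSet ↔
        (x ∈ G.edgeSet ∧ x ≠ e) ∨ (x = e ∧ x ∉ G.edgeSet) := by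
    have h1 : x ∈ G.edgeSet → ¬ x.IsDiag := G.not_isDiag_of_mem_edgeSet
    have h2 : x = e → ¬ x.IsDiag := fun h => h ▸ he
    rw [SimpleGraph.edgeSet_fromEdgeSet]
    simp only [Set.mem_sdiff, Set.mem_symmDiff, Set.mem_singleton_iff, Sym2.mem_diagSet]
    tauto
  have inv (G : SimpleGraph (Fin n)) : SimpleGraph.fromEdgeSet (symmDiff
      (SimpleGraph.fromEdgeSet (symmDiff G.edgeSet {e})).edgeSet {e}) = G := by
    apply SimpleGraph.edgeSet_injective
    ext x
    rw [mem, mem]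
    by_cases hx : x = e
    · simp [hx]
    · simp [hx]
  have key : ∑ G : SimpleGraph (Fin n), (if e ∈ G.edgeSet then a else b) =
      ∑ G : SimpleGraph (Fin n), (if e ∈ G.edgeSet then b else a) := by
    refine Finset.sum_bij' (fun G _ => SimpleGraph.fromEdgeSet (symmDiff G.edgeSet {e}))
      (fun G _ => SimpleGraph.fromEdgeSet (symmDiff G.edgeSet {e})) (by simp) (by simp)
      (fun G _ => inv G) (fun G _ => inv G) ?_
    intro G _
    have := mem G e
    by_cases h : e ∈ G.edgeSet
    · rw [if_pos h, if_neg]; tauto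
    · rw [if_neg h, if_pos]; tauto
  have h2 : ex (fun G => if e ∈ G.edgeSet then a else b) =
      ex (fun G => if e ∈ G.edgeSet then b else a) := by
    simp only [ex, key]
  have h3 : ex (fun G => (if e ∈ G.edgeSet then a else b) + (if e ∈ G.edgeSet then b else a))
      = a + b := by
    rw [← ex_const (n := n) (a + b)]
    congr 1
    funext G
    split_ifs <;> ring
  rw [ex_add] at h3
  linarith

/-- The two potential edges joining `w` to `u` and `v`. -/
def cherry (u v w : Fin n) : Set (Sym2 (Fin n)) := {s(w, u), s(w, v)}

lemma detBy_cherry {α : Type*} (u v w : Fin n) (a b : α) :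
    DetBy (fun G => if G.Adj w u ∧ G.Adj w v then a else b) (cherry u v w) := by
  intro G H h
  have h1 := h s(w, u) (by simp [cherry])
  have h2 := h s(w, v) (by simp [cherry])
  simp only [SimpleGraph.mem_edgeSet] at h1 h2
  simp only [h1, h2]

lemma ex_cherry {u v w : Fin n} (huv : u ≠ v) (hwu : w ≠ u) (hwv : w ≠ v) (a b : ℝ) :
    ex (fun G => if G.Adj w u ∧ G.Adj w v then a else b) = (a + 3 * b) / 4 := by
  have h : (fun G : SimpleGraph (Fin n) => if G.Adj w u ∧ G.Adj w v then a else b) =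
      fun G => b + (a - b) * ((if s(w, u) ∈ G.edgeSet then 1 else 0) *
        (if s(w, v) ∈ G.edgeSet then 1 else 0)) := by
    funext G
    simp only [SimpleGraph.mem_edgeSet]
    by_cases h1 : G.Adj w u <;> by_cases h2 : G.Adj w v <;> simp [h1, h2]
  rw [h, ex_add, ex_const_mul, ex_const, ex_mul (detBy_edge _ _ _) (detBy_edge _ _ _),
    ex_edge (by simpa using hwu), ex_edge (by simpa using hwv)]
  · ring
  · rw [Set.disjoint_singleton]
    intro h
    rw [Sym2.congr_right] at h
    exact huv h

lemma cherry_disjoint {u v w w' : Fin n} (hwu : w ≠ u) (hwv : w ≠ v) (h : w ≠ w') :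
    Disjoint (cherry u v w) (cherry u v w') := by
  rw [Set.disjoint_left]
  simp only [cherry, Set.mem_insert_iff, Set.mem_singleton_iff]
  rintro e (rfl | rfl) (h' | h') <;>
  · simp only [Sym2.eq_iff] at h'
    tauto

lemma ex_mul_prod_edges_mul_prod_cherries {f : SimpleGraph (Fin n) → ℝ}
    {D : Set (Sym2 (Fin n))} (hf : DetBy f D) {F : Finset (Sym2 (Fin n))} {W : Finset (Fin n)}
    {u v : Fin n} (huv : u ≠ v) (hu : u ∉ W) (hv : v ∉ W) (hF : ∀ e ∈ F, ¬ e.IsDiag)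
    (hDF : ∀ e ∈ F, e ∉ D) (hDW : ∀ w ∈ W, Disjoint D (cherry u v w))
    (hFW : ∀ w ∈ W, ∀ e ∈ F, e ∉ cherry u v w) (a b c d : ℝ) :
    ex (fun G => f G * ((∏ e ∈ F, if e ∈ G.edgeSet then a else b) *
      ∏ w ∈ W, if G.Adj w u ∧ G.Adj w v then c else d)) =
    ex f * (((a + b) / 2) ^ #F * ((c + 3 * d) / 4) ^ #W) := by
  have hwu : ∀ w ∈ W, w ≠ u := fun w hw h => hu (h ▸ hw)
  have hwv : ∀ w ∈ W, w ≠ v := fun w hw h => hv (h ▸ hw)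
  have d1 : DetBy (fun G => ∏ e ∈ F, if e ∈ G.edgeSet then a else b) (⋃ e ∈ F, {e}) :=
    detBy_prod F fun e _ => detBy_edge e a b
  have d2 : DetBy (fun G => ∏ w ∈ W, if G.Adj w u ∧ G.Adj w v then c else d)
      (⋃ w ∈ W, cherry u v w) := detBy_prod W fun w _ => detBy_cherry u v w c d
  have d3 : DetBy (fun G => (∏ e ∈ F, if e ∈ G.edgeSet then a else b) *
      ∏ w ∈ W, if G.Adj w u ∧ G.Adj w v then c else d)
      ((⋃ e ∈ F, {e}) ∪ ⋃ w ∈ W, cherry u v w) := by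
    intro G H h
    have h1 := d1.mono Set.subset_union_left G H h
    have h2 := d2.mono Set.subset_union_right G H h
    simp only at h1 h2 ⊢
    rw [h1, h2]
  rw [ex_mul hf d3, ex_mul d1 d2,
    ex_prod F (fun e _ => detBy_edge e a b), ex_prod W (fun w _ => detBy_cherry u v w c d),
    Finset.prod_congr rfl (fun e he => ex_edge (hF e he) a b),
    Finset.prod_congr rfl (fun w hw => ex_cherry huv (hwu w hw) (hwv w hw) c d)]
  · simp only [Finset.prod_const]
  · exact fun w hw w' _ h => cherry_disjoint (hwu w hw) (hwv w hw) h
  · intro i _ j _ h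
    simpa using h
  · simp only [Set.disjoint_iUnion₂_left, Set.disjoint_iUnion₂_right, Set.disjoint_singleton_left]
    exact hFW
  · simp only [Set.disjoint_union_right, Set.disjoint_iUnion₂_right, Set.disjoint_singleton_right]
    exact ⟨fun e he => hDF e he, hDW⟩

end Expectation

/-- The pairs of distinct elements of `T`. -/
noncomputable def pairs {n : ℕ} (T : Finset (Fin n)) : Finset (Sym2 (Fin n)) :=
  T.offDiag.image (Function.uncurry Sym2.mk)

/-- No element of `F` is an edge and no vertex of `W` is adjacent to both `u` and `v`. -/
def Good {n : ℕ} (u v : Fin n) (F : Finset (Sym2 (Fin n))) (W : Finset (Fin n))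
    (G : SimpleGraph (Fin n)) : Prop :=
  (∀ e ∈ F, e ∉ G.edgeSet) ∧ ∀ w ∈ W, ¬(G.Adj w u ∧ G.Adj w v)

/-- Indicator of `Good`. -/
noncomputable def goodInd {n : ℕ} (u v : Fin n) (F : Finset (Sym2 (Fin n))) (W : Finset (Fin n))
    (G : SimpleGraph (Fin n)) : ℝ :=
  if Good u v F W G then 1 else 0

/-- Factor gained by an overlap of size `l`. -/
noncomputable def wt (l : ℕ) : ℝ := 2 ^ l.choose 2 * (4 / 3) ^ l

/-- Probability that a given `k`-set is independent and covers a given edge. -/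
noncomputable def coverPr (k : ℕ) : ℝ := (1 / 2) ^ k.choose 2 * (3 / 4) ^ k

/-- Indicator that `S` induces `i` or `i + 1` edges. -/
noncomputable def fewInd {n : ℕ} (S : Finset (Fin n)) (i : ℕ) (G : SimpleGraph (Fin n)) : ℝ :=
  if edgesIn G S = i ∨ edgesIn G S = i + 1 then 1 else 0

section Events

variable {n : ℕ}

lemma wt_pos (l : ℕ) : 0 < wt l := by unfold wt; positivity

lemma coverPr_pos (k : ℕ) : 0 < coverPr k := by unfold coverPr; positivity

lemma goodInd_nonneg (u v : Fin n) (F : Finset (Sym2 (Fin n))) (W : Finset (Fin n))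
    (G : SimpleGraph (Fin n)) : 0 ≤ goodInd u v F W G := by
  unfold goodInd; split_ifs <;> norm_num

lemma fewInd_nonneg (S : Finset (Fin n)) (i : ℕ) (G : SimpleGraph (Fin n)) :
    0 ≤ fewInd S i G := by
  unfold fewInd; split_ifs <;> norm_num

lemma card_pairs (T : Finset (Fin n)) : #(pairs T) = (#T).choose 2 := Sym2.card_image_offDiag T

lemma mem_pairs {T : Finset (Fin n)} {e : Sym2 (Fin n)} :
    e ∈ pairs T ↔ (∀ x ∈ e, x ∈ T) ∧ ¬ e.IsDiag := by
  induction e with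
  | _ x y =>
    simp only [pairs, Finset.mem_image, Finset.mem_offDiag, Prod.exists,
      Function.uncurry_apply_pair,
      Sym2.mem_iff, forall_eq_or_imp, forall_eq, Sym2.mk_isDiag_iff]
    constructor
    · rintro ⟨a, b, ⟨ha, hb, hab⟩, h⟩
      rw [Sym2.eq_iff] at h
      rcases h with ⟨rfl, rfl⟩ | ⟨rfl, rfl⟩
      · exact ⟨⟨ha, hb⟩, hab⟩
      · exact ⟨⟨hb, ha⟩, Ne.symm hab⟩
    · rintro ⟨⟨hx, hy⟩, hxy⟩
      exact ⟨x, y, ⟨hx, hy, hxy⟩, rfl⟩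

lemma pairs_inter (T T' : Finset (Fin n)) : pairs T ∩ pairs T' = pairs (T ∩ T') := by
  ext e
  simp only [Finset.mem_inter, mem_pairs]
  grind

lemma edgesIn_eq (G : SimpleGraph (Fin n)) (T : Finset (Fin n)) :
    edgesIn G T = #{e ∈ pairs T | e ∈ G.edgeSet} := by
  rw [edgesIn, ← Set.ncard_coe_finset]
  congr 1
  ext e
  have := G.not_isDiag_of_mem_edgeSet (e := e)
  simp only [Set.mem_ofPred_eq, Finset.coe_filter, mem_pairs]
  tauto

lemma edgesIn_eq_zero_iff (G : SimpleGraph (Fin n)) (T : Finset (Fin n)) :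
    edgesIn G T = 0 ↔ ∀ e ∈ pairs T, e ∉ G.edgeSet := by
  rw [edgesIn_eq, Finset.card_eq_zero, Finset.filter_eq_empty_iff]

lemma detBy_edgesIn (S : Finset (Fin n)) : DetBy (fun G => edgesIn G S) (pairs S) := by
  intro G H h
  simp only [edgesIn_eq]
  congr 1
  exact Finset.filter_congr fun e he => h e he

lemma detBy_fewInd (S : Finset (Fin n)) (i : ℕ) : DetBy (fewInd S i) (pairs S) :=
  (detBy_edgesIn S).comp fun x => if x = i ∨ x = i + 1 then (1 : ℝ) else 0

lemma detBy_goodInd (u v : Fin n) (F : Finset (Sym2 (Fin n))) (W : Finset (Fin n)) :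
    DetBy (goodInd u v F W) (F ∪ ⋃ w ∈ W, cherry u v w) := by
  intro G H h
  have : Good u v F W G ↔ Good u v F W H := by
    unfold Good
    refine and_congr (forall₂_congr fun e he => not_congr (h e (Or.inl he)))
      (forall₂_congr fun w hw => not_congr (and_congr ?_ ?_))
    · exact h s(w, u) (Or.inr (Set.mem_biUnion hw (by simp [cherry])))
    · exact h s(w, v) (Or.inr (Set.mem_biUnion hw (by simp [cherry])))
  simp only [goodInd, this]

lemma goodInd_eq (u v : Fin n) (F : Finset (Sym2 (Fin n))) (W : Finset (Fin n))
    (G : SimpleGraph (Fin n)) :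
    goodInd u v F W G = (∏ e ∈ F, if e ∈ G.edgeSet then (0 : ℝ) else 1) *
      ∏ w ∈ W, if G.Adj w u ∧ G.Adj w v then (0 : ℝ) else 1 := by
  have h1 : (∏ e ∈ F, if e ∈ G.edgeSet then (0 : ℝ) else 1) =
      ∏ e ∈ F, if e ∉ G.edgeSet then (1 : ℝ) else 0 :=
    Finset.prod_congr rfl fun e _ => by split_ifs <;> simp_all
  have h2 : (∏ w ∈ W, if G.Adj w u ∧ G.Adj w v then (0 : ℝ) else 1) =
      ∏ w ∈ W, if ¬(G.Adj w u ∧ G.Adj w v) then (1 : ℝ) else 0 :=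
    Finset.prod_congr rfl fun w _ => by rw [ite_not]
  rw [h1, h2, Finset.prod_boole, Finset.prod_boole, goodInd, Good]
  split_ifs <;> simp_all

lemma goodInd_mul (u v : Fin n) (F F' : Finset (Sym2 (Fin n))) (W W' : Finset (Fin n))
    (G : SimpleGraph (Fin n)) :
    goodInd u v F W G * goodInd u v F' W' G = goodInd u v (F ∪ F') (W ∪ W') G := by
  have : Good u v (F ∪ F') (W ∪ W') G ↔ Good u v F W G ∧ Good u v F' W' G := by
    simp only [Good, Finset.mem_union, or_imp, forall_and]
    tauto
  unfold goodInd
  by_cases h1 : Good u v F W G <;> by_cases h2 : Good u v F' W' G <;> simp [this, h1, h2]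

lemma goodInd_anti {u v : Fin n} {F F' : Finset (Sym2 (Fin n))} {W W' : Finset (Fin n)}
    (hF : F ⊆ F') (hW : W ⊆ W') (G : SimpleGraph (Fin n)) :
    goodInd u v F' W' G ≤ goodInd u v F W G := by
  unfold goodInd
  split_ifs with h1 h2 h2
  · exact le_rfl
  · exact absurd ⟨fun e he => h1.1 e (hF he), fun w hw => h1.2 w (hW hw)⟩ h2
  · exact zero_le_one
  · exact le_rfl

lemma ex_mul_goodInd {f : SimpleGraph (Fin n) → ℝ}
    {D : Set (Sym2 (Fin n))} (hf : DetBy f D) {F : Finset (Sym2 (Fin n))} {W : Finset (Fin n)}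
    {u v : Fin n} (huv : u ≠ v) (hu : u ∉ W) (hv : v ∉ W) (hF : ∀ e ∈ F, ¬ e.IsDiag)
    (hDF : ∀ e ∈ F, e ∉ D) (hDW : ∀ w ∈ W, Disjoint D (cherry u v w))
    (hFW : ∀ w ∈ W, ∀ e ∈ F, e ∉ cherry u v w) :
    ex (fun G => f G * goodInd u v F W G) = ex f * ((1 / 2) ^ #F * (3 / 4) ^ #W) := by
  simp only [goodInd_eq]
  rw [ex_mul_prod_edges_mul_prod_cherries hf huv hu hv hF hDF hDW hFW]
  norm_num

lemma not_mem_cherry_of_mem_pairs {T : Finset (Fin n)} {u v w : Fin n} (hu : u ∉ T) (hv : v ∉ T)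
    {e : Sym2 (Fin n)} (he : e ∈ pairs T) : e ∉ cherry u v w := by
  rw [mem_pairs] at he
  rintro (rfl | rfl)
  · exact hu (he.1 u (by simp))
  · exact hv (he.1 v (by simp))

lemma pow_sub_mul_pow_sub {k a x : ℕ} (ha : a ≤ k) (hx : x + a.choose 2 = k.choose 2) :
    ((1 / 2) ^ x * (3 / 4) ^ (k - a) : ℝ) = coverPr k * wt a := by
  obtain ⟨b, rfl⟩ := Nat.exists_eq_add_of_le ha
  rw [coverPr, wt, ← hx, Nat.add_sub_cancel_left, pow_add, pow_add]
  have h1 : ((1 / 2) ^ a.choose 2 * 2 ^ a.choose 2 : ℝ) = 1 := by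
    rw [← mul_pow]; norm_num
  have h2 : ((3 / 4) ^ a * (4 / 3) ^ a : ℝ) = 1 := by
    rw [← mul_pow]; norm_num
  calc ((1 / 2) ^ x * (3 / 4) ^ b : ℝ) = (1 / 2) ^ x * (3 / 4) ^ b *
        ((1 / 2) ^ a.choose 2 * 2 ^ a.choose 2) * ((3 / 4) ^ a * (4 / 3) ^ a) := by
          rw [h1, h2]; ring
    _ = _ := by ring

lemma ex_goodInd {T : Finset (Fin n)} {u v : Fin n} (huv : u ≠ v) (hu : u ∉ T) (hv : v ∉ T) :
    ex (goodInd u v (pairs T) T) = coverPr #T := by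
  have h := ex_mul_goodInd (f := fun _ => 1) (D := ∅) (fun _ _ _ => rfl) (F := pairs T) huv hu hv
    (fun e he => (mem_pairs.1 he).2) (by simp) (by simp)
    (fun w _ e he => not_mem_cherry_of_mem_pairs hu hv he)
  simpa [ex_const, coverPr, card_pairs] using h

lemma ex_mul_goodInd_le {f : SimpleGraph (Fin n) → ℝ} (hf0 : ∀ G, 0 ≤ f G)
    {S T : Finset (Fin n)} (hf : DetBy f (pairs S)) {u v : Fin n} (huv : u ≠ v)
    (hu : u ∉ T) (hv : v ∉ T) :
    ex (fun G => f G * goodInd u v (pairs T) T G) ≤ ex f * (coverPr #T * wt #(T ∩ S)) := by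
  have hF : #(pairs T \ pairs S) + (#(T ∩ S)).choose 2 = (#T).choose 2 := by
    rw [← card_pairs, ← card_pairs, ← pairs_inter, Finset.card_sdiff_add_card_inter]
  have hW : #(T \ S) = #T - #(T ∩ S) := by
    have := Finset.card_sdiff_add_card_inter T S
    omega
  calc ex (fun G => f G * goodInd u v (pairs T) T G)
      ≤ ex (fun G => f G * goodInd u v (pairs T \ pairs S) (T \ S) G) :=
        ex_mono fun G => mul_le_mul_of_nonneg_left
          (goodInd_anti Finset.sdiff_subset Finset.sdiff_subset G) (hf0 G)
    _ = ex f * ((1 / 2) ^ #(pairs T \ pairs S) * (3 / 4) ^ #(T \ S)) := by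
        refine ex_mul_goodInd hf huv (fun h => hu (Finset.sdiff_subset h))
          (fun h => hv (Finset.sdiff_subset h)) ?_ ?_ ?_ ?_
        · exact fun e he => (mem_pairs.1 (Finset.sdiff_subset he)).2
        · exact fun e he => (Finset.mem_sdiff.1 he).2
        · intro w hw
          rw [Set.disjoint_left]
          intro e he hew
          rw [Finset.mem_coe, mem_pairs] at he
          refine (Finset.mem_sdiff.1 hw).2 (he.1 w ?_)
          rcases hew with rfl | rfl <;> simp
        · exact fun w _ e he => not_mem_cherry_of_mem_pairs hu hv (Finset.sdiff_subset he)
    _ = _ := by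
        rw [hW, pow_sub_mul_pow_sub (Finset.card_le_card Finset.inter_subset_left) hF]

lemma ex_goodInd_mul_goodInd {T T' : Finset (Fin n)} {u v : Fin n} (huv : u ≠ v)
    (hu : u ∉ T) (hv : v ∉ T) (hu' : u ∉ T') (hv' : v ∉ T') :
    ex (fun G => goodInd u v (pairs T) T G * goodInd u v (pairs T') T' G) =
      coverPr #T * (coverPr #T' * wt #(T' ∩ T)) := by
  have hF : #(pairs T' \ pairs T) + (#(T' ∩ T)).choose 2 = (#T').choose 2 := by
    rw [← card_pairs, ← card_pairs, ← pairs_inter, Finset.card_sdiff_add_card_inter]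
  have hW : #(T' \ T) = #T' - #(T' ∩ T) := by
    have := Finset.card_sdiff_add_card_inter T' T
    omega
  have h := ex_mul_goodInd (f := fun _ => 1) (D := ∅) (fun _ _ _ => rfl)
    (F := pairs T ∪ pairs T') (W := T ∪ T') huv (by simp [hu, hu']) (by simp [hv, hv'])
    (fun e he => by
      rcases Finset.mem_union.1 he with he | he <;> exact (mem_pairs.1 he).2) (by simp) (by simp)
    (fun w _ e he => by
      rcases Finset.mem_union.1 he with he | he
      exacts [not_mem_cherry_of_mem_pairs hu hv he, not_mem_cherry_of_mem_pairs hu' hv' he])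
  simp only [goodInd_mul]
  simp only [one_mul, ex_const] at h
  rw [h, ← Finset.union_sdiff_self_eq_union, Finset.card_union_of_disjoint Finset.disjoint_sdiff,
    ← Finset.union_sdiff_self_eq_union, Finset.card_union_of_disjoint Finset.disjoint_sdiff,
    pow_add, pow_add, hW,
    ← pow_sub_mul_pow_sub (Finset.card_le_card Finset.inter_subset_left) hF, card_pairs, coverPr]
  ring

lemma ex_fewInd_le {S : Finset (Fin n)} (i : ℕ) (hS : 2 ≤ #S) :
    ex (fewInd S i) ≤ 3 * ((#S).choose 2 : ℝ) ^ (i + 1) * (1 / 2) ^ (#S).choose 2 := by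
  set m := (#S).choose 2 with hm
  have hm1 : 1 ≤ m := Nat.choose_pos hS
  have hm1' : (1 : ℝ) ≤ m := by exact_mod_cast hm1
  have hm0 : (0 : ℝ) < m := by linarith
  calc ex (fewInd S i)
      ≤ ex (fun G => (m : ℝ) ^ (i + 1) *
          ∏ e ∈ pairs S, if e ∈ G.edgeSet then (1 / m : ℝ) else 1) := by
        refine ex_mono fun G => ?_
        rw [Finset.prod_ite]
        simp only [Finset.prod_const_one, mul_one, Finset.prod_const, fewInd, edgesIn_eq]
        split_ifs with h
        · have hle : #{e ∈ pairs S | e ∈ G.edgeSet} ≤ i + 1 := by omega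
          rw [one_div, inv_pow, ← div_eq_mul_inv, one_le_div (by positivity)]
          exact pow_le_pow_right₀ hm1' hle
        · positivity
    _ = (m : ℝ) ^ (i + 1) * ((1 / m + 1) / 2) ^ m := by
        rw [ex_const_mul, ex_prod (pairs S) (fun e _ => detBy_edge e (1 / m : ℝ) 1),
          Finset.prod_congr rfl (fun e he => ex_edge (mem_pairs.1 he).2 _ _)]
        · simp only [Finset.prod_const, card_pairs, hm]
        · intro i _ j _ h
          simpa using h
    _ ≤ _ := by
        have h1 : (1 / m + 1 : ℝ) ^ m ≤ 3 := by
          have h2 : (1 / m + 1 : ℝ) ^ m ≤ Real.exp (1 / m) ^ m :=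
            pow_le_pow_left₀ (by positivity) (Real.add_one_le_exp _) _
          rw [← Real.exp_nat_mul, mul_one_div_cancel hm0.ne'] at h2
          linarith [Real.exp_one_lt_d9]
        calc (m : ℝ) ^ (i + 1) * ((1 / m + 1) / 2) ^ m
            = (1 / m + 1) ^ m * (m : ℝ) ^ (i + 1) * (1 / 2) ^ m := by
              rw [div_pow (1 / m + 1 : ℝ), div_pow (1 : ℝ) 2, one_pow]
              ring
          _ ≤ _ := by gcongr

end Events

/-- Number of independent `k`-sets disjoint from `S` that cover `uv`. -/
noncomputable def outerCovers {n : ℕ} (k : ℕ) (S : Finset (Fin n)) (u v : Fin n)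
    (G : SimpleGraph (Fin n)) : ℝ :=
  ∑ T ∈ powersetCard k Sᶜ, goodInd u v (pairs T) T G

/-- The `k`-sets meeting `A` in at least one and in fewer than `k` vertices. -/
noncomputable def overlapping {n : ℕ} (k : ℕ) (A : Finset (Fin n)) : Finset (Finset (Fin n)) :=
  {T ∈ powersetCard k univ | (T ∩ A).Nonempty ∧ #(T ∩ A) < k}

/-- `R` bounds the average weight of the overlap with a set of at most `k + 1` vertices. -/
def OverlapBound (n k : ℕ) (R : ℝ) : Prop :=
  ∀ A : Finset (Fin n), #A ≤ k + 1 → ∑ T ∈ overlapping k A, wt #(T ∩ A) ≤ n.choose k * R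

/-- A `(k + 1)`-set together with an ordered pair of distinct elements. -/
noncomputable def markedSets (n k : ℕ) : Finset (Σ _ : Finset (Fin n), Fin n × Fin n) :=
  (powersetCard (k + 1) univ).sigma fun S => S.offDiag

/-- Bound for the expected number of marked `(k + 1)`-sets inducing `i` or `i + 1` edges. -/
noncomputable def markedBound (n k i : ℕ) : ℝ :=
  n.choose (k + 1) * (k + 1) ^ 2 *
    (3 * ((k + 1).choose 2 : ℝ) ^ (i + 1) * (1 / 2) ^ (k + 1).choose 2)

section UnionBounds

variable {n : ℕ}

lemma grPr_le_sum {ι : Type*} (J : Finset ι) {A : Set (SimpleGraph (Fin n))}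
    {f : ι → SimpleGraph (Fin n) → ℝ} (h0 : ∀ j ∈ J, ∀ G, 0 ≤ f j G)
    (h1 : ∀ G ∈ A, ∃ j ∈ J, 1 ≤ f j G) : grPr n A ≤ ∑ j ∈ J, ex (f j) := by
  rw [← ex_sum]
  refine grPr_le_ex (fun G => Finset.sum_nonneg fun j hj => h0 j hj G) fun G hG => ?_
  obtain ⟨j, hj, h⟩ := h1 G hG
  exact h.trans (Finset.single_le_sum (f := fun j => f j G) (fun j hj => h0 j hj G) hj)

lemma mem_markedSets {k : ℕ} {S : Finset (Fin n)} {u v : Fin n} :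
    (⟨S, (u, v)⟩ : Σ _ : Finset (Fin n), Fin n × Fin n) ∈ markedSets n k ↔
      #S = k + 1 ∧ u ∈ S ∧ v ∈ S ∧ u ≠ v := by
  simp [markedSets, Finset.mem_sigma, Finset.mem_powersetCard, Finset.mem_offDiag]

lemma card_markedSets_le (n k : ℕ) :
    (#(markedSets n k) : ℝ) ≤ n.choose (k + 1) * (k + 1) ^ 2 := by
  have : #(markedSets n k) ≤ n.choose (k + 1) * (k + 1) ^ 2 := by
    rw [markedSets, Finset.card_sigma]
    calc ∑ S ∈ powersetCard (k + 1) (univ : Finset (Fin n)), #S.offDiag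
        ≤ ∑ S ∈ powersetCard (k + 1) (univ : Finset (Fin n)), (k + 1) ^ 2 := by
          refine Finset.sum_le_sum fun S hS => ?_
          rw [Finset.offDiag_card, (Finset.mem_powersetCard.1 hS).2, sq]
          exact Nat.sub_le _ _
      _ = _ := by simp
  exact_mod_cast this

lemma sum_markedSets_le {k i : ℕ} (hk : 1 ≤ k) {B : ℝ} (hB : 0 ≤ B)
    {f : (Σ _ : Finset (Fin n), Fin n × Fin n) → ℝ}
    (hf : ∀ S u v, #S = k + 1 → u ∈ S → v ∈ S → u ≠ v → f ⟨S, (u, v)⟩ ≤ ex (fewInd S i) * B) :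
    ∑ j ∈ markedSets n k, f j ≤ markedBound n k i * B := by
  have h : ∀ j ∈ markedSets n k,
      f j ≤ 3 * ((k + 1).choose 2 : ℝ) ^ (i + 1) * (1 / 2) ^ (k + 1).choose 2 * B := by
    rintro ⟨S, u, v⟩ hj
    obtain ⟨hS, hu, hv, huv⟩ := mem_markedSets.1 hj
    refine (hf S u v hS hu hv huv).trans (mul_le_mul_of_nonneg_right ?_ hB)
    have := ex_fewInd_le (S := S) i (by omega)
    rwa [hS] at this
  refine (Finset.sum_le_sum h).trans ?_
  rw [Finset.sum_const, nsmul_eq_mul, markedBound, mul_assoc ((n.choose (k + 1) : ℝ) * (k + 1) ^ 2)]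
  exact mul_le_mul_of_nonneg_right (card_markedSets_le n k) (by positivity)

lemma disjoint_pairs_of_disjoint {S T : Finset (Fin n)} (h : Disjoint T S) (u v : Fin n) :
    (↑(pairs T) ∪ ⋃ w ∈ T, cherry u v w : Set (Sym2 (Fin n))) ⊆ (↑(pairs S))ᶜ := by
  intro e he heS
  rw [Finset.mem_coe, mem_pairs] at heS
  rcases he with he | he
  · induction e with
    | _ x y =>
      rw [Finset.mem_coe, mem_pairs] at he
      exact Finset.disjoint_left.1 h (he.1 x (by simp)) (heS.1 x (by simp))
  · simp only [Set.mem_iUnion] at he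
    obtain ⟨w, hw, he⟩ := he
    refine Finset.disjoint_left.1 h hw (heS.1 w ?_)
    rcases he with rfl | rfl <;> simp

lemma detBy_goodInd_compl {S T : Finset (Fin n)} (h : Disjoint T S) (u v : Fin n) :
    DetBy (goodInd u v (pairs T) T) (↑(pairs S))ᶜ :=
  (detBy_goodInd u v (pairs T) T).mono (disjoint_pairs_of_disjoint h u v)

lemma mem_powersetCard_compl {k : ℕ} {S T : Finset (Fin n)} :
    T ∈ powersetCard k Sᶜ ↔ Disjoint T S ∧ #T = k := by
  rw [Finset.mem_powersetCard, Finset.subset_compl_iff_disjoint_right]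

lemma detBy_outerCovers (k : ℕ) (S : Finset (Fin n)) (u v : Fin n) :
    DetBy (outerCovers k S u v) (↑(pairs S))ᶜ := fun G H h =>
  Finset.sum_congr rfl fun _ hT =>
    detBy_goodInd_compl (mem_powersetCard_compl.1 hT).1 u v G H h

lemma outerCovers_le_numCovers (k : ℕ) {S : Finset (Fin n)} {u v : Fin n} (hu : u ∈ S)
    (hv : v ∈ S) (G : SimpleGraph (Fin n)) : outerCovers k S u v G ≤ numCovers n k G u v := by
  rw [outerCovers, numCovers]
  simp only [goodInd]
  rw [Finset.sum_boole, ← Set.ncard_coe_finset]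
  refine Nat.cast_le.2 (Set.ncard_le_ncard (fun T hT => ?_) (Set.toFinite _))
  simp only [Finset.coe_filter, mem_powersetCard_compl] at hT
  obtain ⟨⟨hTS, hTk⟩, hg⟩ := hT
  exact ⟨hTk, (edgesIn_eq_zero_iff G T).2 hg.1, fun h => Finset.disjoint_left.1 hTS h hu,
    fun h => Finset.disjoint_left.1 hTS h hv, hg.2⟩

lemma mul_expY_eq (n k : ℕ) : (3 / 4 : ℝ) ^ k * expY n k = n.choose k * coverPr k := by
  rw [expY, coverPr, div_pow (1 : ℝ), one_pow]
  ring

lemma coverPr_mul_wt_self (k : ℕ) : coverPr k * wt k = 1 := by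
  rw [← pow_sub_mul_pow_sub le_rfl (zero_add _)]
  simp

lemma overlap_lt_of_ne {k : ℕ} {T T' : Finset (Fin n)} (hT : #T = k) (hT' : #T' = k)
    (h : T' ≠ T) : #(T' ∩ T) < k := by
  refine lt_of_le_of_ne (hT' ▸ Finset.card_le_card Finset.inter_subset_left) fun hc => h ?_
  have h1 : T' ∩ T = T' := Finset.eq_of_subset_of_card_le Finset.inter_subset_left (by omega)
  have h2 : T' ∩ T = T := Finset.eq_of_subset_of_card_le Finset.inter_subset_right (by omega)
  exact h1.symm.trans h2

lemma ex_outerCovers {k : ℕ} {S : Finset (Fin n)} (hS : #S = k + 1) {u v : Fin n} (huv : u ≠ v)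
    (hu : u ∈ S) (hv : v ∈ S) :
    ex (outerCovers k S u v) = (n - (k + 1)).choose k * coverPr k := by
  have : ex (outerCovers k S u v) = ∑ T ∈ powersetCard k Sᶜ, ex (goodInd u v (pairs T) T) :=
    ex_sum _ _
  rw [this, Finset.sum_congr rfl (g := fun _ => coverPr k)]
  · simp [Finset.card_compl, hS]
  · intro T hT
    rw [mem_powersetCard_compl] at hT
    rw [ex_goodInd huv (fun h => Finset.disjoint_left.1 hT.1 h hu)
      (fun h => Finset.disjoint_left.1 hT.1 h hv), hT.2]

lemma card_powersetCard_compl_le (k : ℕ) (S : Finset (Fin n)) :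
    (#(powersetCard k Sᶜ) : ℝ) ≤ n.choose k := by
  rw [Finset.card_powersetCard]
  have : #Sᶜ ≤ n := by simpa using Finset.card_le_univ Sᶜ
  exact_mod_cast Nat.choose_le_choose k this

lemma ex_outerCovers_sq_le {k : ℕ} {R : ℝ} (hR : 0 ≤ R) (h : OverlapBound n k R)
    {S : Finset (Fin n)} {u v : Fin n} (huv : u ≠ v)
    (hu : u ∈ S) (hv : v ∈ S) :
    ex (fun G => outerCovers k S u v G ^ 2) ≤ (#(powersetCard k Sᶜ) * coverPr k) ^ 2 +
      (n.choose k * coverPr k + (n.choose k * coverPr k) ^ 2 * R) := by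
  have hc := (coverPr_pos k).le
  have h1 : ex (fun G => outerCovers k S u v G ^ 2) =
      ∑ T ∈ powersetCard k Sᶜ, ∑ T' ∈ powersetCard k Sᶜ,
        ex (fun G => goodInd u v (pairs T) T G * goodInd u v (pairs T') T' G) := by
    simp only [outerCovers, sq, Finset.sum_mul_sum]
    rw [ex_sum]
    simp only [ex_sum]
  have h2 : ∀ T ∈ powersetCard k Sᶜ, ∑ T' ∈ powersetCard k Sᶜ,
        ex (fun G => goodInd u v (pairs T) T G * goodInd u v (pairs T') T' G) ≤
      #(powersetCard k Sᶜ) * coverPr k ^ 2 +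
        (coverPr k + n.choose k * coverPr k ^ 2 * R) := by
    intro T hT
    have hT1 := mem_powersetCard_compl.1 hT
    calc _ ≤ ∑ T' ∈ powersetCard k Sᶜ, (coverPr k ^ 2 + ((if T' = T then coverPr k else 0) +
          if T' ∈ overlapping k T then coverPr k ^ 2 * wt #(T' ∩ T) else 0)) := by
          refine Finset.sum_le_sum fun T' hT' => ?_
          have hT1' := mem_powersetCard_compl.1 hT'
          rw [ex_goodInd_mul_goodInd huv (fun h => Finset.disjoint_left.1 hT1.1 h hu)
            (fun h => Finset.disjoint_left.1 hT1.1 h hv)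
            (fun h => Finset.disjoint_left.1 hT1'.1 h hu)
            (fun h => Finset.disjoint_left.1 hT1'.1 h hv), hT1.2, hT1'.2]
          have hw := wt_pos #(T' ∩ T)
          by_cases he : T' = T
          · subst he
            rw [Finset.inter_self, hT1.2, coverPr_mul_wt_self, if_pos rfl]
            have := wt_pos k
            split_ifs
            · nlinarith [sq_nonneg (coverPr k)]
            · nlinarith [sq_nonneg (coverPr k)]
          · rw [if_neg he]
            by_cases hne : (T' ∩ T).Nonempty
            · rw [if_pos]
              · nlinarith [sq_nonneg (coverPr k)]
              · simp only [overlapping, Finset.mem_filter, Finset.mem_powersetCard_univ]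
                exact ⟨hT1'.2, hne, overlap_lt_of_ne hT1.2 hT1'.2 he⟩
            · rw [Finset.not_nonempty_iff_eq_empty.1 hne]
              have : (0 : ℝ) ≤ if T' ∈ overlapping k T then
                coverPr k ^ 2 * wt #(∅ : Finset (Fin n)) else 0 := by
                  have := wt_pos #(∅ : Finset (Fin n))
                  split_ifs <;> positivity
              have h0 : wt #(∅ : Finset (Fin n)) = 1 := by simp [wt]
              rw [h0] at this ⊢
              linarith [sq (coverPr k)]
      _ ≤ _ := by
          rw [Finset.sum_add_distrib, Finset.sum_add_distrib, Finset.sum_const, nsmul_eq_mul]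
          gcongr
          · rw [Finset.sum_ite_eq' _ _ (fun _ => coverPr k), if_pos hT]
          · rw [← Finset.sum_filter, mul_comm (n.choose k : ℝ), mul_assoc]
            calc _ ≤ ∑ T' ∈ overlapping k T, coverPr k ^ 2 * wt #(T' ∩ T) := by
                  refine Finset.sum_le_sum_of_subset_of_nonneg
                    (fun T' hT' => (Finset.mem_filter.1 hT').2) fun T' _ _ => ?_
                  have := wt_pos #(T' ∩ T)
                  positivity
              _ ≤ _ := by
                  rw [← Finset.mul_sum]
                  exact mul_le_mul_of_nonneg_left (h T (by omega)) (by positivity)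
  rw [h1]
  refine (Finset.sum_le_sum h2).trans ?_
  rw [Finset.sum_const, nsmul_eq_mul, mul_add]
  have hcard := card_powersetCard_compl_le k S
  refine add_le_add (le_of_eq (by ring)) ?_
  calc (#(powersetCard k Sᶜ) : ℝ) * (coverPr k + n.choose k * coverPr k ^ 2 * R)
      ≤ n.choose k * (coverPr k + n.choose k * coverPr k ^ 2 * R) :=
        mul_le_mul_of_nonneg_right hcard (by positivity)
    _ = _ := by ring

lemma ex_outerCovers_small_le {k : ℕ} {R : ℝ} (hR : 0 ≤ R) (h : OverlapBound n k R)
    (hchoose : 3 / 4 * (n.choose k : ℝ) ≤ (n - (k + 1)).choose k) (hpos : 0 < n.choose k)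
    {S : Finset (Fin n)} (hS : #S = k + 1) {u v : Fin n} (huv : u ≠ v)
    (hu : u ∈ S) (hv : v ∈ S) :
    ex (fun G => if outerCovers k S u v G ≤ n.choose k * coverPr k / 2 then (1 : ℝ) else 0) ≤
      16 * (1 / (n.choose k * coverPr k) + R) := by
  have hc := coverPr_pos k
  have hpos' : (0 : ℝ) < n.choose k := by exact_mod_cast hpos
  have h2 := ex_outerCovers_sq_le hR h huv hu hv
  have h1 := ex_outerCovers hS huv hu hv
  have hcard : (#(powersetCard k Sᶜ) : ℝ) = (n - (k + 1)).choose k := by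
    simp [Finset.card_compl, hS]
  rw [hcard] at h2
  set M : ℝ := n.choose k * coverPr k with hM
  set μ : ℝ := (n - (k + 1)).choose k * coverPr k with hμ
  have hM0 : 0 < M := by positivity
  have hμM : 3 / 4 * M ≤ μ := by
    rw [hM, hμ, ← mul_assoc]
    exact mul_le_mul_of_nonneg_right hchoose hc.le
  calc ex (fun G => if outerCovers k S u v G ≤ M / 2 then (1 : ℝ) else 0)
      ≤ ex (fun G => 16 / M ^ 2 * (outerCovers k S u v G ^ 2 +
          (-(2 * μ) * outerCovers k S u v G + μ ^ 2))) := by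
        refine ex_mono fun G => ?_
        have hsq : outerCovers k S u v G ^ 2 + (-(2 * μ) * outerCovers k S u v G + μ ^ 2) =
          (μ - outerCovers k S u v G) ^ 2 := by ring
        rw [hsq]
        split_ifs with hle
        · rw [div_mul_eq_mul_div, one_le_div (by positivity)]
          nlinarith
        · positivity
    _ = 16 / M ^ 2 * (ex (fun G => outerCovers k S u v G ^ 2) - μ ^ 2) := by
        rw [ex_const_mul, ex_add, ex_add, ex_const_mul, ex_const]
        rw [h1]
        ring
    _ ≤ 16 / M ^ 2 * (M + M ^ 2 * R) :=
        mul_le_mul_of_nonneg_left (by linarith) (by positivity)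
    _ = _ := by field_simp

lemma grPr_few_covers_le {k i : ℕ} (hk : 1 ≤ k) {R : ℝ} (hR : 0 ≤ R) (h : OverlapBound n k R)
    (hchoose : 3 / 4 * (n.choose k : ℝ) ≤ (n - (k + 1)).choose k) (hpos : 0 < n.choose k) :
    grPr n {G | ∃ S : Finset (Fin n), S.card = k + 1 ∧
          (edgesIn G S = i ∨ edgesIn G S = i + 1) ∧
          ∃ u ∈ S, ∃ v ∈ S, G.Adj u v ∧
            (numCovers n k G u v : ℝ) ≤ (3 / 4 : ℝ) ^ k * expY n k / 2} ≤
      markedBound n k i * (16 * (1 / ((3 / 4 : ℝ) ^ k * expY n k) + R)) := by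
  rw [mul_expY_eq]
  set M : ℝ := n.choose k * coverPr k
  have hM0 : 0 ≤ M := mul_nonneg (Nat.cast_nonneg _) (coverPr_pos k).le
  refine (grPr_le_sum (markedSets n k) (f := fun j G => fewInd j.1 i G *
    if outerCovers k j.1 j.2.1 j.2.2 G ≤ M / 2 then (1 : ℝ) else 0) ?_ ?_).trans
    (sum_markedSets_le hk (by positivity) ?_)
  · intro j _ G
    exact mul_nonneg (fewInd_nonneg _ _ _) (by split_ifs <;> norm_num)
  · rintro G ⟨S, hS, hi, u, hu, v, hv, hadj, hle⟩
    refine ⟨⟨S, (u, v)⟩, mem_markedSets.2 ⟨hS, hu, hv, hadj.ne⟩, ?_⟩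
    simp only [fewInd]
    rw [if_pos hi, if_pos ((outerCovers_le_numCovers k hu hv G).trans hle)]
    norm_num
  · intro S u v hS hu hv huv
    simp only
    rw [ex_mul (detBy_fewInd S i) ((detBy_outerCovers k S u v).comp
      fun x => if x ≤ M / 2 then (1 : ℝ) else 0) disjoint_compl_right]
    exact mul_le_mul_of_nonneg_left (ex_outerCovers_small_le hR h hchoose hpos hS huv hu hv)
      (ex_nonneg fun G => fewInd_nonneg S i G)

lemma grPr_overlapping_covers_le {k i : ℕ} (hk : 1 ≤ k) {R : ℝ} (hR : 0 ≤ R)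
    (h : OverlapBound n k R) :
    grPr n {G | ∃ S : Finset (Fin n), S.card = k + 1 ∧
          (edgesIn G S = i ∨ edgesIn G S = i + 1) ∧
          ∃ u ∈ S, ∃ v ∈ S, G.Adj u v ∧
            ∃ T₁ T₂ : Finset (Fin n), T₁ ≠ T₂ ∧ (T₁ ∩ T₂).Nonempty ∧
              T₁.card = k ∧ edgesIn G T₁ = 0 ∧ Covers G T₁ u v ∧
              T₂.card = k ∧ edgesIn G T₂ = 0 ∧ Covers G T₂ u v} ≤
      markedBound n k i * (((3 / 4 : ℝ) ^ k * expY n k) * R +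
        ((3 / 4 : ℝ) ^ k * expY n k) ^ 2 * R) := by
  rw [mul_expY_eq]
  have hc := (coverPr_pos k).le
  let touch (S : Finset (Fin n)) (u v : Fin n) : Finset (Finset (Fin n)) :=
    {T ∈ overlapping k S | u ∉ T ∧ v ∉ T}
  let partner (S T : Finset (Fin n)) : Finset (Finset (Fin n)) :=
    {T' ∈ overlapping k T | Disjoint T' S}
  refine (grPr_le_sum (markedSets n k) (f := fun j G =>
    ∑ T ∈ touch j.1 j.2.1 j.2.2, fewInd j.1 i G * goodInd j.2.1 j.2.2 (pairs T) T G +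
    ∑ T ∈ powersetCard k j.1ᶜ, ∑ T' ∈ partner j.1 T, fewInd j.1 i G *
      (goodInd j.2.1 j.2.2 (pairs T) T G * goodInd j.2.1 j.2.2 (pairs T') T' G)) ?_ ?_).trans
    (sum_markedSets_le hk (by positivity) ?_)
  · intro j _ G
    refine add_nonneg (Finset.sum_nonneg fun T _ => ?_)
      (Finset.sum_nonneg fun T _ => Finset.sum_nonneg fun T' _ => ?_)
    · exact mul_nonneg (fewInd_nonneg _ _ _) (goodInd_nonneg _ _ _ _ _)
    · exact mul_nonneg (fewInd_nonneg _ _ _)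
        (mul_nonneg (goodInd_nonneg _ _ _ _ _) (goodInd_nonneg _ _ _ _ _))
  · rintro G ⟨S, hS, hi, u, hu, v, hv, hadj, T₁, T₂, hne, hint, hk₁, h0₁, hcov₁, hk₂, h0₂, hcov₂⟩
    refine ⟨⟨S, (u, v)⟩, mem_markedSets.2 ⟨hS, hu, hv, hadj.ne⟩, ?_⟩
    have hfew : fewInd S i G = 1 := if_pos hi
    have hg : ∀ T : Finset (Fin n), edgesIn G T = 0 → Covers G T u v →
        goodInd u v (pairs T) T G = 1 := fun T h0 hcov =>
      if_pos ⟨(edgesIn_eq_zero_iff G T).1 h0, hcov.2.2⟩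
    have hlt : ∀ T : Finset (Fin n), Covers G T u v → #(T ∩ S) < k := by
      intro T hcov
      have hsub : T ∩ S ⊆ (S.erase u).erase v := by
        intro x hx
        rw [Finset.mem_inter] at hx
        rw [Finset.mem_erase, Finset.mem_erase]
        exact ⟨fun h => hcov.2.1 (h ▸ hx.1), fun h => hcov.1 (h ▸ hx.1), hx.2⟩
      have := Finset.card_le_card hsub
      rw [Finset.card_erase_of_mem (Finset.mem_erase.2 ⟨hadj.ne', hv⟩),
        Finset.card_erase_of_mem hu] at this
      omega
    have hA : ∀ T : Finset (Fin n), #T = k → edgesIn G T = 0 → Covers G T u v →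
        (T ∩ S).Nonempty →
        1 ≤ ∑ T ∈ touch S u v, fewInd S i G * goodInd u v (pairs T) T G := by
      intro T hT h0 hcov hTS
      refine le_trans (b := fewInd S i G * goodInd u v (pairs T) T G) ?_
        (Finset.single_le_sum (f := fun T => fewInd S i G * goodInd u v (pairs T) T G)
          (fun T _ => mul_nonneg (fewInd_nonneg _ _ _) (goodInd_nonneg _ _ _ _ _)) ?_)
      · rw [hfew, hg T h0 hcov, one_mul]
      · simp only [touch, overlapping, Finset.mem_filter, Finset.mem_powersetCard_univ]
        exact ⟨⟨hT, hTS, hlt T hcov⟩, hcov.1, hcov.2.1⟩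
    have hnn : ∀ T T', 0 ≤ fewInd S i G *
        (goodInd u v (pairs T) T G * goodInd u v (pairs T') T' G) := fun T T' =>
      mul_nonneg (fewInd_nonneg _ _ _)
        (mul_nonneg (goodInd_nonneg _ _ _ _ _) (goodInd_nonneg _ _ _ _ _))
    have hB0 : 0 ≤ ∑ T ∈ powersetCard k Sᶜ, ∑ T' ∈ partner S T, fewInd S i G *
        (goodInd u v (pairs T) T G * goodInd u v (pairs T') T' G) :=
      Finset.sum_nonneg fun T _ => Finset.sum_nonneg fun T' _ => hnn T T'
    by_cases h₁ : (T₁ ∩ S).Nonempty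
    · exact le_add_of_le_of_nonneg (hA T₁ hk₁ h0₁ hcov₁ h₁) hB0
    by_cases h₂ : (T₂ ∩ S).Nonempty
    · exact le_add_of_le_of_nonneg (hA T₂ hk₂ h0₂ hcov₂ h₂) hB0
    rw [Finset.not_nonempty_iff_eq_empty, ← Finset.disjoint_iff_inter_eq_empty] at h₁ h₂
    refine le_add_of_nonneg_of_le (Finset.sum_nonneg fun T _ =>
      mul_nonneg (fewInd_nonneg _ _ _) (goodInd_nonneg _ _ _ _ _)) ?_
    calc (1 : ℝ) ≤ fewInd S i G * (goodInd u v (pairs T₁) T₁ G * goodInd u v (pairs T₂) T₂ G) := by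
          rw [hfew, hg T₁ h0₁ hcov₁, hg T₂ h0₂ hcov₂]; norm_num
      _ ≤ ∑ T' ∈ partner S T₁, fewInd S i G *
          (goodInd u v (pairs T₁) T₁ G * goodInd u v (pairs T') T' G) := by
          refine Finset.single_le_sum (f := fun T' => fewInd S i G *
            (goodInd u v (pairs T₁) T₁ G * goodInd u v (pairs T') T' G))
            (fun T' _ => hnn T₁ T') ?_
          simp only [partner, overlapping, Finset.mem_filter, Finset.mem_powersetCard_univ]
          refine ⟨⟨hk₂, ?_, overlap_lt_of_ne hk₁ hk₂ hne.symm⟩, h₂⟩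
          rwa [Finset.inter_comm]
      _ ≤ _ := Finset.single_le_sum (f := fun T => ∑ T' ∈ partner S T, fewInd S i G *
            (goodInd u v (pairs T) T G * goodInd u v (pairs T') T' G))
            (fun T _ => Finset.sum_nonneg fun T' _ => hnn T T')
            (mem_powersetCard_compl.2 ⟨h₁, hk₁⟩)
  · intro S u v hS hu hv huv
    simp only
    have hE : 0 ≤ ex (fewInd S i) := ex_nonneg fun G => fewInd_nonneg S i G
    rw [ex_add, mul_add]
    refine add_le_add ?_ ?_
    · rw [ex_sum]
      calc _ ≤ ∑ T ∈ touch S u v, ex (fewInd S i) * (coverPr k * wt #(T ∩ S)) := by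
            refine Finset.sum_le_sum fun T hT => ?_
            simp only [touch, overlapping, Finset.mem_filter,
              Finset.mem_powersetCard_univ] at hT
            obtain ⟨⟨hTk, -⟩, huT, hvT⟩ := hT
            have := ex_mul_goodInd_le (fewInd_nonneg S i) (detBy_fewInd S i) huv huT hvT
            rwa [hTk] at this
        _ ≤ ∑ T ∈ overlapping k S, ex (fewInd S i) * (coverPr k * wt #(T ∩ S)) :=
            Finset.sum_le_sum_of_subset_of_nonneg (Finset.filter_subset _ _) fun T _ _ =>
              mul_nonneg hE (mul_nonneg hc (wt_pos _).le)
        _ = ex (fewInd S i) * (coverPr k * ∑ T ∈ overlapping k S, wt #(T ∩ S)) := by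
            rw [Finset.mul_sum, Finset.mul_sum]
        _ ≤ ex (fewInd S i) * (coverPr k * (n.choose k * R)) := by
            gcongr
            exact h S hS.le
        _ = _ := by ring
    · rw [ex_sum]
      simp only [ex_sum]
      calc _ ≤ ∑ T ∈ powersetCard k Sᶜ, ex (fewInd S i) * (coverPr k ^ 2 * (n.choose k * R)) := by
            refine Finset.sum_le_sum fun T hT => ?_
            obtain ⟨hTS, hTk⟩ := mem_powersetCard_compl.1 hT
            calc _ ≤ ∑ T' ∈ partner S T, ex (fewInd S i) * (coverPr k ^ 2 * wt #(T' ∩ T)) := by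
                  refine Finset.sum_le_sum fun T' hT' => ?_
                  simp only [partner, overlapping, Finset.mem_filter,
                    Finset.mem_powersetCard_univ] at hT'
                  obtain ⟨⟨hTk', -⟩, hTS'⟩ := hT'
                  have hdet : DetBy (fun G => goodInd u v (pairs T) T G *
                      goodInd u v (pairs T') T' G) (↑(pairs S))ᶜ := by
                    intro G H hGH
                    simp only
                    rw [detBy_goodInd_compl hTS u v G H hGH,
                      detBy_goodInd_compl hTS' u v G H hGH]
                  rw [ex_mul (detBy_fewInd S i) hdet disjoint_compl_right,
                    ex_goodInd_mul_goodInd huv (fun h => Finset.disjoint_left.1 hTS h hu)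
                    (fun h => Finset.disjoint_left.1 hTS h hv)
                    (fun h => Finset.disjoint_left.1 hTS' h hu)
                    (fun h => Finset.disjoint_left.1 hTS' h hv), hTk, hTk', sq, mul_assoc]
              _ ≤ ∑ T' ∈ overlapping k T, ex (fewInd S i) * (coverPr k ^ 2 * wt #(T' ∩ T)) :=
                  Finset.sum_le_sum_of_subset_of_nonneg (Finset.filter_subset _ _) fun T _ _ =>
                    mul_nonneg hE (mul_nonneg (sq_nonneg _) (wt_pos _).le)
              _ = ex (fewInd S i) * (coverPr k ^ 2 * ∑ T' ∈ overlapping k T, wt #(T' ∩ T)) := by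
                  rw [Finset.mul_sum, Finset.mul_sum]
              _ ≤ _ := by
                  gcongr
                  exact h T (by omega)
        _ = #(powersetCard k Sᶜ) * (ex (fewInd S i) * (coverPr k ^ 2 * (n.choose k * R))) := by
            rw [Finset.sum_const, nsmul_eq_mul]
        _ ≤ n.choose k * (ex (fewInd S i) * (coverPr k ^ 2 * (n.choose k * R))) :=
            mul_le_mul_of_nonneg_right (card_powersetCard_compl_le k S) (by positivity)
        _ = _ := by ring

end UnionBounds

section OverlapEstimates

variable {n : ℕ}

lemma card_filter_superset_le (k : ℕ) (B : Finset (Fin n)) :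
    #{T ∈ powersetCard k (univ : Finset (Fin n)) | B ⊆ T} ≤ (n - #B).choose (k - #B) := by
  have : (n - #B).choose (k - #B) = #(powersetCard (k - #B) Bᶜ) := by
    rw [Finset.card_powersetCard, Finset.card_compl, Fintype.card_fin]
  rw [this]
  refine Finset.card_le_card_of_injOn (fun T => T \ B) ?_ ?_
  · intro T hT
    simp only [Finset.coe_filter, Finset.mem_powersetCard_univ] at hT
    rw [Finset.mem_coe, Finset.mem_powersetCard, Finset.card_sdiff_of_subset hT.2, hT.1]
    exact ⟨fun x hx => Finset.mem_compl.2 (Finset.mem_sdiff.1 hx).2, rfl⟩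
  · intro T hT T' hT' h
    simp only [Finset.coe_filter] at hT hT'
    simp only at h
    rw [← Finset.sdiff_union_of_subset hT.2, h, Finset.sdiff_union_of_subset hT'.2]

lemma card_filter_inter_eq_le {k l : ℕ} {A : Finset (Fin n)} (hA : #A ≤ k + 1) :
    #{T ∈ powersetCard k (univ : Finset (Fin n)) | #(T ∩ A) = l} ≤
      (k + 1).choose l * (n - l).choose (k - l) := by
  calc #{T ∈ powersetCard k (univ : Finset (Fin n)) | #(T ∩ A) = l}
      ≤ #((powersetCard l A).biUnion fun B =>
          {T ∈ powersetCard k (univ : Finset (Fin n)) | B ⊆ T}) := by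
        refine Finset.card_le_card fun T hT => ?_
        rw [Finset.mem_filter] at hT
        rw [Finset.mem_biUnion]
        exact ⟨T ∩ A, Finset.mem_powersetCard.2 ⟨Finset.inter_subset_right, hT.2⟩,
          Finset.mem_filter.2 ⟨hT.1, Finset.inter_subset_left⟩⟩
    _ ≤ ∑ B ∈ powersetCard l A, #{T ∈ powersetCard k (univ : Finset (Fin n)) | B ⊆ T} :=
        Finset.card_biUnion_le
    _ ≤ ∑ B ∈ powersetCard l A, (n - l).choose (k - l) := by
        refine Finset.sum_le_sum fun B hB => ?_
        have := card_filter_superset_le k B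
        rwa [(Finset.mem_powersetCard.1 hB).2] at this
    _ ≤ _ := by
        rw [Finset.sum_const, smul_eq_mul, Finset.card_powersetCard]
        exact Nat.mul_le_mul_right _ (Nat.choose_le_choose l hA)

lemma overlapBound_of_forall_le {k : ℕ} {B : ℝ} (hB : 0 ≤ B)
    (h : ∀ l, 1 ≤ l → l < k →
      ((k + 1).choose l * (n - l).choose (k - l) : ℝ) * wt l ≤ n.choose k * B) :
    OverlapBound n k (k * B) := by
  intro A hA
  have hmaps : ∀ T ∈ overlapping k A, #(T ∩ A) ∈ Finset.Ico 1 k := by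
    intro T hT
    rw [overlapping, Finset.mem_filter] at hT
    exact Finset.mem_Ico.2 ⟨Finset.card_pos.2 hT.2.1, hT.2.2⟩
  rw [← Finset.sum_fiberwise_of_maps_to hmaps]
  calc _ ≤ ∑ l ∈ Finset.Ico 1 k, n.choose k * B := by
        refine Finset.sum_le_sum fun l hl => ?_
        rw [Finset.mem_Ico] at hl
        refine le_trans ?_ (h l hl.1 hl.2)
        rw [Finset.sum_congr rfl (g := fun _ => wt l)
          (fun T hT => by rw [(Finset.mem_filter.1 hT).2]), Finset.sum_const, nsmul_eq_mul]
        refine mul_le_mul_of_nonneg_right ?_ (wt_pos l).le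
        have h1 : #{T ∈ overlapping k A | #(T ∩ A) = l} ≤
            #{T ∈ powersetCard k (univ : Finset (Fin n)) | #(T ∩ A) = l} :=
          Finset.card_le_card (Finset.filter_subset_filter _ (Finset.filter_subset _ _))
        exact_mod_cast h1.trans (card_filter_inter_eq_le hA)
    _ ≤ k * (n.choose k * B) := by
        rw [Finset.sum_const, nsmul_eq_mul, Nat.card_Ico]
        refine mul_le_mul_of_nonneg_right ?_ (by positivity)
        exact_mod_cast Nat.sub_le k 1
    _ = _ := by ring

lemma choose_sub_mul_pow_le {k l : ℕ} (hlk : l ≤ k) (hkn : 2 * k ≤ n) :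
    ((n - l).choose (k - l) : ℝ) * (n : ℝ) ^ l ≤ n.choose k * (2 * k) ^ l := by
  have h1 : (n.choose k * k.choose l : ℝ) = n.choose l * (n - l).choose (k - l) := by
    exact_mod_cast Nat.choose_mul (n := n) hlk
  have h2 : (k.choose l : ℝ) ≤ k ^ l / l.factorial := Nat.choose_le_pow_div l k
  have h3 : ((n + 1 - l : ℕ) ^ l / l.factorial : ℝ) ≤ n.choose l := Nat.pow_le_choose l n
  have h4 : (n : ℝ) / 2 ≤ (n + 1 - l : ℕ) := by
    have : n ≤ 2 * (n + 1 - l) := by omega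
    have : (n : ℝ) ≤ 2 * (n + 1 - l : ℕ) := by exact_mod_cast this
    linarith
  have hf : (0 : ℝ) < l.factorial := by exact_mod_cast l.factorial_pos
  have h5 : ((n : ℝ) / 2) ^ l ≤ l.factorial * n.choose l := by
    rw [div_le_iff₀' hf] at h3
    exact (pow_le_pow_left₀ (by positivity) h4 l).trans h3
  rw [le_div_iff₀' hf] at h2
  calc ((n - l).choose (k - l) : ℝ) * (n : ℝ) ^ l
      = (n - l).choose (k - l) * (n / 2) ^ l * 2 ^ l := by
        rw [div_pow]; field_simp
    _ ≤ (n - l).choose (k - l) * (l.factorial * n.choose l) * 2 ^ l := by gcongr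
    _ = n.choose k * (l.factorial * k.choose l) * 2 ^ l := by
        linear_combination (-(l.factorial : ℝ) * 2 ^ l) * h1
    _ ≤ n.choose k * k ^ l * 2 ^ l := by gcongr
    _ = _ := by rw [mul_pow]; ring

lemma two_pow_choose_two_le {l : ℕ} (h : (2 : ℝ) ^ l ≤ n) :
    (2 : ℝ) ^ l.choose 2 ≤ √n ^ (l - 1) := by
  refine le_of_sq_le_sq ?_ (by positivity)
  rw [← pow_mul, pow_right_comm, Real.sq_sqrt (Nat.cast_nonneg n), Nat.choose_two_right,
    Nat.div_mul_cancel (Nat.even_mul_pred_self l).two_dvd, pow_mul]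
  exact pow_le_pow_left₀ (by positivity) h _

lemma two_pow_le_of_two_mul_le {k l : ℕ} (h : (2 : ℝ) ^ k ≤ n ^ 2) (hl : 2 * l ≤ k) :
    (2 : ℝ) ^ l ≤ n := by
  refine le_of_sq_le_sq ?_ (Nat.cast_nonneg n)
  rw [← pow_mul, mul_comm]
  exact (pow_le_pow_right₀ (by norm_num) hl).trans h

lemma small_overlap_le {k l : ℕ} (hl : 1 ≤ l) (hlk : 2 * l ≤ k) (h : (2 : ℝ) ^ k ≤ n ^ 2)
    (hkn : 3 * (k + 1 : ℝ) ^ 2 ≤ √n) :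
    ((k + 1).choose l * (n - l).choose (k - l) : ℝ) * wt l ≤
      n.choose k * (3 * (k + 1) ^ 2 / n) := by
  have hr : 0 < √n := lt_of_lt_of_le (by positivity) hkn
  have hn : (0 : ℝ) < n := Real.sqrt_pos.1 hr
  have hrr : √n ^ 2 = n := Real.sq_sqrt hn.le
  have h2k : 2 * k ≤ n := by
    have hk0 : (0 : ℝ) ≤ k := Nat.cast_nonneg k
    have h3 : 3 ≤ √n := by nlinarith
    have : (2 * k : ℝ) ≤ n := by nlinarith
    exact_mod_cast this
  have h1 := choose_sub_mul_pow_le (by omega : l ≤ k) h2k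
  have h2 := two_pow_choose_two_le (two_pow_le_of_two_mul_le h hlk)
  have h3 : ((k + 1).choose l : ℝ) ≤ (k + 1) ^ l := by exact_mod_cast Nat.choose_le_pow _ _
  have h4 : (√n : ℝ) ^ (l - 1) = √n ^ l / √n := by
    rw [eq_div_iff hr.ne', ← pow_succ, Nat.sub_add_cancel hl]
  rw [← le_div_iff₀ (by positivity)] at h1
  calc ((k + 1).choose l * (n - l).choose (k - l) : ℝ) * wt l
      ≤ ((k + 1) ^ l * (n.choose k * (2 * k) ^ l / n ^ l)) * (√n ^ l / √n * (4 / 3) ^ l) := by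
        unfold wt
        rw [h4] at h2
        gcongr
    _ = n.choose k * ((8 / 3 * (k * (k + 1)) / √n) ^ l / √n) := by
        have hnl : (n : ℝ) ^ l = √n ^ l * √n ^ l := by
          rw [← mul_pow, Real.mul_self_sqrt hn.le]
        rw [hnl]
        simp only [div_pow, mul_pow]
        rw [show (8 : ℝ) = 2 * 4 by norm_num, mul_pow]
        field_simp
    _ ≤ n.choose k * ((3 * (k + 1) ^ 2 / √n) ^ l / √n) := by
        have hk0 : (0 : ℝ) ≤ k := Nat.cast_nonneg k
        refine mul_le_mul_of_nonneg_left ?_ (Nat.cast_nonneg _)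
        gcongr ?_ ^ l / √n
        gcongr ?_ / √n
        nlinarith
    _ ≤ n.choose k * ((3 * (k + 1) ^ 2 / √n) / √n) := by
        gcongr
        exact pow_le_of_le_one (by positivity) (by rw [div_le_one hr]; exact hkn) (by omega)
    _ = _ := by rw [div_div, Real.mul_self_sqrt hn.le]

lemma large_overlap_le {k j : ℕ} (hj : 1 ≤ j) (hjk : 2 * j ≤ k) (h : (2 : ℝ) ^ k ≤ n ^ 2)
    (hn : 0 < n) (hpos : 0 < n.choose k) (hkn : 2 * (k + 1 : ℝ) * (n * √n) ≤ 2 ^ k) :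
    ((k + 1).choose (k - j) * (n - (k - j)).choose (k - (k - j)) : ℝ) * wt (k - j) ≤
      n.choose k * (2 * (k + 1) ^ 2 * (n / 2 ^ k) * ((4 / 3) ^ k / expY n k)) := by
  obtain ⟨l, rfl⟩ := Nat.exists_eq_add_of_le (show j ≤ k by omega)
  set k := j + l with hk
  have hn' : (0 : ℝ) < n := by exact_mod_cast hn
  have hr : 0 < √n := Real.sqrt_pos.2 hn'
  have hrr : √n ^ 2 = n := Real.sq_sqrt hn'.le
  have hkj : k - j = l := by omega
  have hkl : k - l = j := by omega
  rw [hkj, hkl]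
  have h1 : ((k + 1).choose l : ℝ) ≤ (k + 1) ^ (j + 1) := by
    have : (k + 1).choose l = (k + 1).choose (j + 1) := by
      rw [← Nat.choose_symm_of_eq_add]; omega
    rw [this]
    exact_mod_cast Nat.choose_le_pow _ _
  have h2 : ((n - l).choose j : ℝ) ≤ n ^ j := by
    have : (n - l).choose j ≤ n ^ j :=
      (Nat.choose_le_pow _ _).trans (Nat.pow_le_pow_left (Nat.sub_le _ _) _)
    exact_mod_cast this
  have h3 := two_pow_choose_two_le (two_pow_le_of_two_mul_le h hjk)
  have h4 : (√n : ℝ) ^ (j - 1) = √n ^ j / √n := by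
    rw [eq_div_iff hr.ne', ← pow_succ, Nat.sub_add_cancel hj]
  rw [h4] at h3
  have h5 : l.choose 2 + j * k = k.choose 2 + j.choose 2 + j := by
    have : (l.choose 2 + j * k : ℝ) = k.choose 2 + j.choose 2 + j := by
      rw [Nat.cast_choose_two, Nat.cast_choose_two, Nat.cast_choose_two, hk]
      push_cast
      ring
    exact_mod_cast this
  have h6 : (2 : ℝ) ^ l.choose 2 = 2 ^ k.choose 2 * (2 ^ j.choose 2 * 2 ^ j / (2 ^ k) ^ j) := by
    rw [mul_div_assoc', eq_div_iff (by positivity), ← pow_mul, mul_comm k j, ← pow_add, h5,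
      pow_add, pow_add, mul_assoc]
  have h7 : (4 / 3 : ℝ) ^ l ≤ (4 / 3) ^ k := pow_le_pow_right₀ (by norm_num) (by omega)
  have h8 : (2 : ℝ) ^ k.choose 2 = n.choose k / expY n k := by
    have : (n.choose k : ℝ) ≠ 0 := by exact_mod_cast hpos.ne'
    rw [expY]; field_simp
  have hX : 0 < expY n k := by
    have : (0 : ℝ) < n.choose k := by exact_mod_cast hpos
    unfold expY; positivity
  calc ((k + 1).choose l * (n - l).choose j : ℝ) * wt l
      ≤ ((k + 1) ^ (j + 1) * n ^ j) * (2 ^ k.choose 2 * (√n ^ j / √n * 2 ^ j / (2 ^ k) ^ j) *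
          (4 / 3) ^ k) := by
        unfold wt
        rw [h6]
        gcongr
    _ = n.choose k * ((k + 1) * ((4 / 3) ^ k / expY n k) *
          ((2 * (k + 1) * (n * √n) / 2 ^ k) ^ j / √n)) := by
        rw [h8, div_pow (2 * (k + 1) * (n * √n) : ℝ)]
        simp only [mul_pow]
        ring
    _ ≤ n.choose k * ((k + 1) * ((4 / 3) ^ k / expY n k) *
          ((2 * (k + 1) * (n * √n) / 2 ^ k) / √n)) := by
        gcongr
        exact pow_le_of_le_one (by positivity) (by rw [div_le_one (by positivity)]; exact hkn)
          (by omega)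
    _ = _ := by field_simp

lemma overlapBound {k : ℕ} (h : (2 : ℝ) ^ k ≤ n ^ 2) (hkn : 3 * (k + 1 : ℝ) ^ 2 ≤ √n)
    (hkn' : 2 * (k + 1 : ℝ) * (n * √n) ≤ 2 ^ k) :
    OverlapBound n k (k * (3 * (k + 1) ^ 2 / n +
      2 * (k + 1) ^ 2 * (n / 2 ^ k) * ((4 / 3) ^ k / expY n k))) := by
  have hr : 0 < √n := lt_of_lt_of_le (by positivity) hkn
  have hn : (0 : ℝ) < n := Real.sqrt_pos.1 hr
  have hrr : √n ^ 2 = n := Real.sq_sqrt hn.le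
  have h2k : k ≤ n := by
    have hk0 : (0 : ℝ) ≤ k := Nat.cast_nonneg k
    have h3 : 3 ≤ √n := by nlinarith
    have : (k : ℝ) ≤ n := by nlinarith
    exact_mod_cast this
  have hX : 0 ≤ expY n k := by unfold expY; positivity
  refine overlapBound_of_forall_le (by positivity) fun l hl hlk => ?_
  rw [mul_add]
  rcases Nat.lt_or_ge k (2 * l) with hlt | hge
  · refine le_add_of_nonneg_of_le (by positivity) ?_
    have := large_overlap_le (j := k - l) (by omega) (by omega) h (by exact_mod_cast hn)
      (Nat.choose_pos h2k) hkn'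
    rwa [Nat.sub_sub_self hlk.le] at this
  · exact le_add_of_le_of_nonneg (small_overlap_le hl hge h hkn) (by positivity)

lemma choose_le_choose_sub_add {k : ℕ} (hk : 1 ≤ k) (m : ℕ) (hm : m ≤ n) :
    n.choose k ≤ (n - m).choose k + m * (n - 1).choose (k - 1) := by
  induction m with
  | zero => simp
  | succ m ih =>
    refine (ih (by omega)).trans ?_
    obtain ⟨a, ha⟩ : ∃ a, n - m = a + 1 := ⟨n - m - 1, by omega⟩
    obtain ⟨b, rfl⟩ := Nat.exists_eq_add_of_le' hk
    have h1 : n - (m + 1) = a := by omega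
    rw [ha, h1, Nat.choose_succ_succ', Nat.add_sub_cancel, add_mul, one_mul]
    have := Nat.choose_le_choose b (show a ≤ n - 1 by omega)
    omega

lemma three_quarters_choose_le {k : ℕ} (hk : 1 ≤ k) (hkn : 4 * ((k + 1) * k) ≤ n) :
    3 / 4 * (n.choose k : ℝ) ≤ (n - (k + 1)).choose k := by
  have h1 := choose_le_choose_sub_add (n := n) hk (k + 1) (by nlinarith)
  have hn : 1 ≤ n := by nlinarith
  have h2 : n * (n - 1).choose (k - 1) = n.choose k * k := by
    obtain ⟨b, rfl⟩ := Nat.exists_eq_add_of_le' hk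
    obtain ⟨a, rfl⟩ := Nat.exists_eq_add_of_le' hn
    exact Nat.add_one_mul_choose_eq a b
  have h3 : n * (4 * ((k + 1) * (n - 1).choose (k - 1))) ≤ n * n.choose k := by
    calc n * (4 * ((k + 1) * (n - 1).choose (k - 1)))
        = 4 * (k + 1) * (n * (n - 1).choose (k - 1)) := by ring
      _ = (4 * ((k + 1) * k)) * n.choose k := by rw [h2]; ring
      _ ≤ _ := Nat.mul_le_mul_right _ hkn
  have h4 := Nat.le_of_mul_le_mul_left h3 hn
  have h5 : (n.choose k : ℝ) ≤ (n - (k + 1)).choose k + (k + 1) * (n - 1).choose (k - 1) := by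
    exact_mod_cast h1
  have h6 : (4 * ((k + 1) * (n - 1).choose (k - 1)) : ℝ) ≤ n.choose k := by exact_mod_cast h4
  linarith

lemma markedBound_le (n k i : ℕ) :
    markedBound n k i ≤ expY n k * (n / 2 ^ k) * (3 * (k + 1) ^ (2 * i + 4)) := by
  have h1 : (n.choose (k + 1) : ℝ) ≤ n.choose k * n := by
    have h : n.choose (k + 1) * (k + 1) = n.choose k * (n - k) := Nat.choose_succ_right_eq n k
    have : n.choose (k + 1) ≤ n.choose k * n :=
      calc n.choose (k + 1) ≤ n.choose (k + 1) * (k + 1) := Nat.le_mul_of_pos_right _ k.succ_pos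
        _ = n.choose k * (n - k) := h
        _ ≤ _ := Nat.mul_le_mul_left _ (Nat.sub_le _ _)
    exact_mod_cast this
  have h2 : ((k + 1).choose 2 : ℝ) ≤ (k + 1) ^ 2 := by
    exact_mod_cast Nat.choose_le_pow _ _
  have h3 : (k + 1).choose 2 = k + k.choose 2 := by
    rw [Nat.choose_succ_succ' k 1, Nat.choose_one_right]
  calc markedBound n k i ≤ (n.choose k * n) * (k + 1) ^ 2 *
        (3 * ((k + 1) ^ 2) ^ (i + 1) * (1 / 2) ^ (k + 1).choose 2) := by
        unfold markedBound
        gcongr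
    _ = _ := by
        rw [h3, expY, div_pow (1 : ℝ), one_pow, ← pow_mul, show 2 * i + 4 = 2 + 2 * (i + 1) by ring,
          pow_add (2 : ℝ), pow_add _ 2]
        field_simp

end OverlapEstimates

section SingleVertex

variable {n : ℕ}

lemma card_le_numCovers_one (G : SimpleGraph (Fin n)) (u v : Fin n) :
    #{w ∈ {u, v}ᶜ | ¬(G.Adj w u ∧ G.Adj w v)} ≤ numCovers n 1 G u v := by
  rw [numCovers, ← Finset.card_map ⟨_, Finset.singleton_injective⟩, ← Set.ncard_coe_finset]
  refine Set.ncard_le_ncard ?_ (Set.toFinite _)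
  intro T hT
  simp only [Finset.coe_map, Function.Embedding.coeFn_mk, Set.mem_image, Finset.mem_coe,
    Finset.mem_filter, Finset.mem_compl, Finset.mem_insert, Finset.mem_singleton, not_or] at hT
  obtain ⟨w, ⟨⟨hwu, hwv⟩, hw⟩, rfl⟩ := hT
  refine ⟨Finset.card_singleton w, ?_, ?_, ?_, ?_⟩
  · rw [edgesIn_eq_zero_iff]
    simp [pairs]
  · simpa using fun h => hwu h.symm
  · simpa using fun h => hwv h.symm
  · simpa using hw

/-- An exponential weight that is at least `1` when few vertices cover `uv`. -/
noncomputable def expWeight (u v : Fin n) (G : SimpleGraph (Fin n)) : ℝ :=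
  (8 / 5) ^ n * ∏ w ∈ {u, v}ᶜ, if G.Adj w u ∧ G.Adj w v then 1 else (1 / 3 : ℝ)

lemma ex_expWeight {u v : Fin n} (huv : u ≠ v) : ex (expWeight u v) = 4 * (4 / 5) ^ n := by
  have hw : ∀ w ∈ ({u, v} : Finset (Fin n))ᶜ, w ≠ u ∧ w ≠ v := fun w hw => by
    simpa using hw
  unfold expWeight
  rw [ex_const_mul, ex_prod _ (fun w _ => detBy_cherry u v w _ _)
    (fun w hw' w' _ h => cherry_disjoint (hw w hw').1 (hw w hw').2 h),
    Finset.prod_congr rfl (fun w hw' => ex_cherry huv (hw w hw').1 (hw w hw').2 _ _),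
    Finset.prod_const, Finset.card_compl, Finset.card_pair huv, Fintype.card_fin]
  have hn : 2 ≤ n := by
    have := Finset.card_le_univ ({u, v} : Finset (Fin n))
    rwa [Finset.card_pair huv, Fintype.card_fin] at this
  obtain ⟨a, rfl⟩ := Nat.exists_eq_add_of_le' hn
  rw [Nat.add_sub_cancel, show (4 / 5 : ℝ) = 8 / 5 * (1 / 2) by norm_num, mul_pow,
    pow_add (1 / 2 : ℝ)]
  norm_num
  ring

lemma one_le_expWeight {u v : Fin n} {G : SimpleGraph (Fin n)}
    (h : (numCovers n 1 G u v : ℝ) ≤ (3 / 4 : ℝ) ^ 1 * expY n 1 / 2) : 1 ≤ expWeight u v G := by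
  set z := #{w ∈ ({u, v} : Finset (Fin n))ᶜ | ¬(G.Adj w u ∧ G.Adj w v)} with hz
  have h8 : 8 * z ≤ 3 * n := by
    have h1 : (z : ℝ) ≤ numCovers n 1 G u v := by exact_mod_cast card_le_numCovers_one G u v
    have h2 : (8 * z : ℝ) ≤ 3 * n := by
      simp only [expY, Nat.choose_one_right, pow_one, Nat.choose_succ_self, pow_zero] at h
      linarith
    exact_mod_cast h2
  have hw : expWeight u v G = (8 / 5) ^ n * (1 / 3) ^ z := by
    rw [expWeight, Finset.prod_ite, Finset.prod_const_one, Finset.prod_const, one_mul, hz]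
  rw [hw, ← one_le_pow_iff_of_nonneg (by positivity) (show 8 ≠ 0 by norm_num)]
  calc (1 : ℝ) = (3 ^ 3) ^ n * (1 / 3) ^ (3 * n) := by
        rw [← pow_mul, ← mul_pow]
        norm_num
    _ ≤ ((8 / 5) ^ 8) ^ n * (1 / 3) ^ (8 * z) := by
        refine mul_le_mul (pow_le_pow_left₀ (by norm_num) (by norm_num) n)
          (pow_le_pow_of_le_one (by norm_num) (by norm_num) h8) (by positivity) (by positivity)
    _ = _ := by
        rw [mul_pow, ← pow_mul, ← pow_mul, ← pow_mul, mul_comm 8 n, mul_comm 8 z]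

lemma grPr_few_vertices_cover_le (P : SimpleGraph (Fin n) → Finset (Fin n) → Prop) :
    grPr n {G | ∃ S : Finset (Fin n), S.card = 1 + 1 ∧ P G S ∧
        ∃ u ∈ S, ∃ v ∈ S, G.Adj u v ∧
          (numCovers n 1 G u v : ℝ) ≤ (3 / 4 : ℝ) ^ 1 * expY n 1 / 2}
      ≤ 4 * (n ^ 2 * (4 / 5) ^ n) := by
  have h := grPr_le_sum (n := n) (univ : Finset (Fin n)).offDiag (f := fun j => expWeight j.1 j.2)
    (A := {G | ∃ S : Finset (Fin n), S.card = 1 + 1 ∧ P G S ∧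
        ∃ u ∈ S, ∃ v ∈ S, G.Adj u v ∧
          (numCovers n 1 G u v : ℝ) ≤ (3 / 4 : ℝ) ^ 1 * expY n 1 / 2})
    (fun j _ G => by
      refine mul_nonneg (by positivity) (Finset.prod_nonneg fun w _ => ?_)
      split_ifs <;> norm_num)
    (fun G hG => by
      obtain ⟨S, -, -, u, -, v, -, huv, h⟩ := hG
      exact ⟨(u, v), by simpa using huv.ne, one_le_expWeight h⟩)
  refine h.trans ?_
  rw [Finset.sum_congr rfl fun j hj => ex_expWeight (by simpa using hj), Finset.sum_const,
    nsmul_eq_mul]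
  have hc : (#(univ : Finset (Fin n)).offDiag : ℝ) ≤ n ^ 2 := by
    rw [Finset.offDiag_card, Finset.card_univ, Fintype.card_fin, sq]
    exact_mod_cast Nat.sub_le _ _
  calc _ ≤ (n : ℝ) ^ 2 * (4 * (4 / 5) ^ n) := by gcongr
    _ = _ := by ring

lemma grPr_overlapping_vertices_cover_eq_zero (P : SimpleGraph (Fin n) → Finset (Fin n) → Prop) :
    grPr n {G | ∃ S : Finset (Fin n), S.card = 1 + 1 ∧ P G S ∧
        ∃ u ∈ S, ∃ v ∈ S, G.Adj u v ∧
          ∃ T₁ T₂ : Finset (Fin n), T₁ ≠ T₂ ∧ (T₁ ∩ T₂).Nonempty ∧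
            T₁.card = 1 ∧ edgesIn G T₁ = 0 ∧ Covers G T₁ u v ∧
            T₂.card = 1 ∧ edgesIn G T₂ = 0 ∧ Covers G T₂ u v} = 0 := by
  convert_to grPr n ∅ = 0
  · congr 1
    refine Set.eq_empty_iff_forall_notMem.2 ?_
    rintro G ⟨S, -, -, u, -, v, -, -, T₁, T₂, hne, ⟨x, hx⟩, h₁, -, -, h₂, -, -⟩
    obtain ⟨a, rfl⟩ := Finset.card_eq_one.1 h₁
    obtain ⟨b, rfl⟩ := Finset.card_eq_one.1 h₂
    simp only [Finset.mem_inter, Finset.mem_singleton] at hx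
    exact hne (by rw [← hx.1, ← hx.2])
  · simp [grPr]

end SingleVertex

section Ranges

open Real

variable {n k i : ℕ}

lemma two_pow_pred_le_factorial (k : ℕ) : 2 ^ (k - 1) ≤ k.factorial := by
  induction k with
  | zero => simp
  | succ k ih =>
    rcases k with - | k
    · simp
    · rw [Nat.factorial_succ, Nat.add_sub_cancel, pow_succ, mul_comm]
      exact Nat.mul_le_mul (by omega) ih

lemma log_expY (hkn : k ≤ n) :
    log (expY n k) = log (n.choose k) - k * (k - 1) / 2 * log 2 := by
  have : (n.choose k : ℝ) ≠ 0 := by exact_mod_cast (Nat.choose_pos hkn).ne'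
  rw [expY, log_div this (by positivity), log_pow, Nat.cast_choose_two ℝ]

lemma log_choose_le (hk : 1 ≤ k) (hkn : k ≤ n) :
    log (n.choose k) ≤ k * log n - (k - 1) * log 2 := by
  have hn : (0 : ℝ) < n := by exact_mod_cast hk.trans hkn
  have hc : (0 : ℝ) < n.choose k := by exact_mod_cast Nat.choose_pos hkn
  have h1 : (n.choose k : ℝ) ≤ n ^ k / 2 ^ (k - 1) := by
    refine (Nat.choose_le_pow_div k n).trans ?_
    gcongr
    exact_mod_cast two_pow_pred_le_factorial k
  have h2 := log_le_log hc h1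
  rwa [log_div (by positivity) (by positivity), log_pow, log_pow, Nat.cast_sub hk,
    Nat.cast_one] at h2

lemma le_log_choose (hk : 1 ≤ k) (hkn : 2 * k ≤ n) :
    k * log n - k * log (2 * k) ≤ log (n.choose k) := by
  have hn : (0 : ℝ) < n := by exact_mod_cast (show 0 < n by omega)
  have hk' : (0 : ℝ) < k := by exact_mod_cast hk
  have h1 : ((n : ℝ) / (2 * k)) ^ k ≤ n.choose k := by
    refine le_trans ?_ (Nat.pow_le_choose k n)
    calc ((n : ℝ) / (2 * k)) ^ k = (n / 2) ^ k / (k : ℝ) ^ k := by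
          rw [← div_pow]
          congr 1
          field_simp
      _ ≤ _ := by
          have h2 : ((n : ℝ) / 2) ≤ (n + 1 - k : ℕ) := by
            rw [Nat.cast_sub (by omega)]
            push_cast
            have : (2 * k : ℝ) ≤ n := by exact_mod_cast hkn
            linarith
          have h3 : (k.factorial : ℝ) ≤ (k : ℝ) ^ k := by exact_mod_cast k.factorial_le_pow
          have h4 : (0 : ℝ) < k.factorial := by exact_mod_cast k.factorial_pos
          gcongr
  have h2 := log_le_log (by positivity) h1
  rw [log_pow, log_div hn.ne' (by positivity)] at h2
  linarith

lemma mul_log_two_le (hk : 2 ≤ k) (hkn : k ≤ n) (h : 0 ≤ log (expY n k)) :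
    k * log 2 ≤ 2 * log n := by
  have h1 := log_expY hkn
  have h2 := log_choose_le (by omega) hkn
  have hl : 0 < log 2 := log_pos one_lt_two
  have hk' : (2 : ℝ) ≤ k := by exact_mod_cast hk
  have h3 : (k : ℝ) * (k * log 2) ≤ k * (2 * log n) := by
    nlinarith
  exact le_of_mul_le_mul_left h3 (by linarith)

lemma le_mul_log_two (hk : 2 ≤ k) (hkn : 2 * k ≤ n) (hm : 10000000 ≤ log n)
    (hs : log (2 * k) ≤ log n / 8000) (h : log (expY n k) ≤ 6 / 5 * log n) :
    1999 / 1000 * log n ≤ k * log 2 := by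
  have h1 := log_expY (n := n) (k := k) (by omega)
  have h2 := le_log_choose (by omega) hkn
  have hl : 0 < log 2 := log_pos one_lt_two
  have hl1 : log 2 ≤ 1 := log_two_lt_d9.le.trans (by norm_num)
  have hk' : (2 : ℝ) ≤ k := by exact_mod_cast hk
  by_contra! hlt
  have hk800 : (k : ℝ) ≤ 801 := by
    have h3 : (k : ℝ) * log (2 * k) ≤ 2 * (k - 1) * (log n / 8000) :=
      mul_le_mul (by linarith) hs (log_nonneg (by linarith)) (by linarith)
    have h4 : ((k : ℝ) - 1) / 2 * (k * log 2) ≤ (k - 1) / 2 * (1999 / 1000 * log n) :=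
      mul_le_mul_of_nonneg_left hlt.le (by linarith)
    have h5 : ((k : ℝ) - 1) * log n ≤ 800 * log n := by
      linarith
    have := le_of_mul_le_mul_right h5 (by linarith)
    linarith
  have h3 : log (2 * k) ≤ 2 * k := log_le_self (by linarith)
  have h4 : (k : ℝ) * log (2 * k) ≤ 801 * 1602 :=
    mul_le_mul hk800 (by linarith) (log_nonneg (by linarith)) (by norm_num)
  have h5 : (k : ℝ) * (k - 1) / 2 * log 2 ≤ 801 * 801 * 1 := by
    refine mul_le_mul ?_ hl1 hl.le (by norm_num)
    nlinarith
  nlinarith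

lemma log_four_thirds_le : log (4 / 3) ≤ 21 / 50 * log 2 := by
  have : log ((4 / 3) ^ 50) ≤ log (2 ^ 21) := log_le_log (by positivity) (by norm_num)
  rw [log_pow, log_pow] at this
  push_cast at this
  linarith

lemma le_log_four_thirds : 83 / 200 * log 2 ≤ log (4 / 3) := by
  have : log (2 ^ 83) ≤ log ((4 / 3) ^ 200) := log_le_log (by positivity) (by norm_num)
  rw [log_pow, log_pow] at this
  push_cast at this
  linarith

end Ranges

section Assembly

open Real

variable {n k i : ℕ}

lemma rpow_eq_exp (hn : 0 < n) (a : ℝ) : (n : ℝ) ^ a = exp (a * log n) := by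
  rw [rpow_def_of_pos (by exact_mod_cast hn), mul_comm]

lemma event_bounds (hn : 0 < n) (hk : 2 ≤ k) (hm : 10000000 ≤ log n)
    (hQ : 5 * ((k : ℝ) + 1) ^ (2 * i + 4) ≤ exp (log n / 8000)) (hX : 0 < expY n k)
    (hX1 : 5 / 6 * log n ≤ log (expY n k)) (hX2 : log (expY n k) ≤ 6 / 5 * log n)
    (hκ1 : 1999 / 1000 * log n ≤ k * log 2) (hκ2 : k * log 2 ≤ 2 * log n) :
    ∃ R : ℝ, 0 ≤ R ∧ OverlapBound n k R ∧
      markedBound n k i * (16 * (1 / ((3 / 4 : ℝ) ^ k * expY n k) + R)) ≤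
        (n : ℝ) ^ (-(1 / 100) : ℝ) ∧
      markedBound n k i * (((3 / 4 : ℝ) ^ k * expY n k) * R +
        ((3 / 4 : ℝ) ^ k * expY n k) ^ 2 * R) ≤ (n : ℝ) ^ (-(1 / 100) : ℝ) := by
  have hn' : (n : ℝ) = exp (log n) := (exp_log (by exact_mod_cast hn)).symm
  have hX' : expY n k = exp (log (expY n k)) := (exp_log hX).symm
  have hmb := markedBound_le n k i
  have hob := overlapBound (n := n) (k := k)
  have h2k : (2 : ℝ) ^ k = exp (k * log 2) := by
    rw [exp_nat_mul, exp_log two_pos]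
  have h43 : ((4 : ℝ) / 3) ^ k = exp (k * log (4 / 3)) := by
    rw [exp_nat_mul, exp_log (by norm_num)]
  have h34 : ((3 : ℝ) / 4) ^ k = exp (-(k * log (4 / 3))) := by
    rw [exp_neg, ← h43, ← inv_pow]
    norm_num
  have hk0 : (0 : ℝ) ≤ k := Nat.cast_nonneg k
  have hθ1 : 829 / 1000 * log n ≤ k * log (4 / 3) := by
    have := mul_le_mul_of_nonneg_left le_log_four_thirds hk0
    linarith
  have hθ2 : k * log (4 / 3) ≤ 84 / 100 * log n := by
    have := mul_le_mul_of_nonneg_left log_four_thirds_le hk0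
    linarith
  rw [rpow_eq_exp hn, h34]
  generalize hmdef : log (n : ℝ) = m at *
  generalize hξdef : log (expY n k) = ξ at *
  generalize k * log (4 / 3) = θ at *
  have hA : (n : ℝ) / 2 ^ k ≤ exp (-(999 / 1000) * m) := by
    rw [hn', h2k, ← exp_sub, exp_le_exp]
    linarith
  have hq : (1 : ℝ) ≤ k + 1 := by linarith
  have hQ4 : 5 * ((k : ℝ) + 1) ^ 4 ≤ exp (m / 8000) := by
    refine le_trans ?_ hQ
    gcongr
    omega
  have hq2 : ((k : ℝ) + 1) ^ 2 ≤ (k + 1) ^ 4 := pow_le_pow_right₀ hq (by norm_num)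
  have hq3 : ((k : ℝ) + 1) ^ 3 ≤ (k + 1) ^ 4 := pow_le_pow_right₀ hq (by norm_num)
  have hq1 : (k : ℝ) + 1 ≤ (k + 1) ^ 4 := le_self_pow₀ hq (by norm_num)
  have hsqrt : √(n : ℝ) = exp (m / 2) := by rw [hn', exp_half]
  have hsmall : exp (m / 8000) ≤ exp (m / 4) := exp_le_exp.2 (by linarith)
  set R : ℝ := k * (3 * (k + 1) ^ 2 / n + 2 * (k + 1) ^ 2 * (n / 2 ^ k) *
    ((4 / 3) ^ k / expY n k)) with hRdef
  have hR0 : 0 ≤ R := by positivity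
  have hR : R ≤ exp (-(992 / 1000) * m) := by
    have h1 : (1 : ℝ) / n ≤ exp (-(9923 / 10000) * m) := by
      rw [hn', one_div, ← exp_neg, exp_le_exp]
      linarith
    have h2 : (n : ℝ) / 2 ^ k * ((4 / 3) ^ k / expY n k) ≤ exp (-(9923 / 10000) * m) := by
      rw [hn', h2k, h43, hX', ← exp_sub, ← exp_sub, ← exp_add, exp_le_exp]
      linarith
    calc R = k * (k + 1) ^ 2 * (3 * (1 / n) + 2 * (n / 2 ^ k * ((4 / 3) ^ k / expY n k))) := by
          rw [hRdef]
          ring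
      _ ≤ (k + 1) * (k + 1) ^ 2 * (3 * exp (-(9923 / 10000) * m) +
            2 * exp (-(9923 / 10000) * m)) := by
          gcongr
          linarith
      _ = 5 * (k + 1) ^ 3 * exp (-(9923 / 10000) * m) := by ring
      _ ≤ exp (m / 8000) * exp (-(9923 / 10000) * m) := by
          gcongr
          linarith
      _ ≤ _ := by
          rw [← exp_add, exp_le_exp]
          linarith
  have hmb' : markedBound n k i ≤ exp (ξ - 998 / 1000 * m) := by
    calc _ ≤ expY n k * (n / 2 ^ k) * (3 * (k + 1) ^ (2 * i + 4)) := hmb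
      _ ≤ exp ξ * exp (-(999 / 1000) * m) * exp (m / 8000) := by
          rw [← hX']
          gcongr
          refine le_trans ?_ hQ
          gcongr
          norm_num
      _ ≤ _ := by
          rw [← exp_add, ← exp_add, exp_le_exp]
          linarith
  have hmb0 : 0 ≤ markedBound n k i := by
    unfold markedBound
    positivity
  have h32 : (32 : ℝ) ≤ exp (m / 100) := by
    have := add_one_le_exp (m / 100)
    linarith
  refine ⟨R, hR0, hob ?_ ?_ ?_, ?_, ?_⟩
  · rw [h2k, hn', ← exp_nat_mul, exp_le_exp]
    push_cast
    linarith
  · rw [hsqrt]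
    have : exp (m / 4) ≤ exp (m / 2) := exp_le_exp.2 (by linarith)
    linarith
  · calc 2 * ((k : ℝ) + 1) * (n * √n) ≤ exp (m / 4) * (exp m * exp (m / 2)) := by
          rw [hsqrt, ← hn']
          gcongr
          linarith
      _ ≤ _ := by
          rw [h2k, ← exp_add, ← exp_add, exp_le_exp]
          linarith
  · calc markedBound n k i * (16 * (1 / (exp (-θ) * expY n k) + R))
        ≤ exp (ξ - 998 / 1000 * m) * (16 * (exp (θ - ξ) + exp (-(992 / 1000) * m))) := by
          rw [hX', ← exp_add, one_div, ← exp_neg, show -(-θ + ξ) = θ - ξ by ring]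
          gcongr
      _ = 16 * (exp (ξ - 998 / 1000 * m + (θ - ξ)) +
            exp (ξ - 998 / 1000 * m + -(992 / 1000) * m)) := by
          rw [exp_add, exp_add]
          ring
      _ ≤ 16 * (exp (-(2 / 100) * m) + exp (-(2 / 100) * m)) := by
          gcongr <;> linarith
      _ = 32 * exp (-(2 / 100) * m) := by ring
      _ ≤ exp (m / 100) * exp (-(2 / 100) * m) := by gcongr
      _ ≤ _ := by
          rw [← exp_add, exp_le_exp]
          linarith
  · calc markedBound n k i * (exp (-θ) * expY n k * R + (exp (-θ) * expY n k) ^ 2 * R)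
        ≤ exp (ξ - 998 / 1000 * m) * (exp (-θ + ξ) * exp (-(992 / 1000) * m) +
            exp (-θ + ξ) ^ 2 * exp (-(992 / 1000) * m)) := by
          rw [hX', ← exp_add]
          gcongr
      _ = exp (ξ - 998 / 1000 * m + (-θ + ξ) + -(992 / 1000) * m) +
            exp (ξ - 998 / 1000 * m + 2 * (-θ + ξ) + -(992 / 1000) * m) := by
          simp only [exp_add, two_mul]
          ring
      _ ≤ exp (-(2 / 100) * m) + exp (-(2 / 100) * m) := by
          gcongr <;> linarith
      _ ≤ 32 * exp (-(2 / 100) * m) := by linarith [exp_pos (-(2 / 100) * m)]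
      _ ≤ exp (m / 100) * exp (-(2 / 100) * m) := by gcongr
      _ ≤ _ := by
          rw [← exp_add, exp_le_exp]
          linarith

end Assembly

section Main

open Real Filter

lemma eventually_log_pow_bound (C : ℝ) (hC : 0 < C) :
    ∀ᶠ m : ℝ in atTop, log 5 + (2 * (C * log m) + 4) * log (4 * m) ≤ m / 8000 := by
  have h := (isLittleO_pow_log_id_atTop (n := 2)).def
    (show (0 : ℝ) < 1 / (8000 * (4 * C + 9)) by positivity)
  filter_upwards [h, tendsto_log_atTop.eventually_ge_atTop 5, eventually_gt_atTop 0]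
    with m h hL hm
  rw [id, norm_of_nonneg (by positivity), norm_of_nonneg hm.le, div_mul_eq_mul_div, one_mul,
    le_div_iff₀ (by positivity)] at h
  rw [log_mul (by norm_num) hm.ne']
  have h5 : log 5 ≤ 5 := log_le_self (by norm_num)
  have h4 : log 4 ≤ 4 := log_le_self (by norm_num)
  have h1 : (2 * (C * log m) + 4) * (log 4 + log m) ≤ (2 * C + 4) * log m * (2 * log m) := by
    refine mul_le_mul ?_ (by linarith) ?_ (by positivity)
    · linarith
    · linarith [log_nonneg (show (1 : ℝ) ≤ 4 by norm_num)]
  nlinarith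

lemma eventually_geometric_bound :
    ∀ᶠ n : ℕ in atTop, 4 * ((n : ℝ) ^ 2 * (4 / 5) ^ n) ≤ (n : ℝ) ^ (-(1 / 100) : ℝ) := by
  have h := tendsto_pow_const_mul_const_pow_of_abs_lt_one 3
    (show |(4 / 5 : ℝ)| < 1 by rw [abs_of_pos] <;> norm_num)
  filter_upwards [h.eventually_le_const (show (0 : ℝ) < 1 / 4 by norm_num),
    eventually_ge_atTop 1] with n h hn
  have hn1 : (1 : ℝ) ≤ n := by exact_mod_cast hn
  calc 4 * ((n : ℝ) ^ 2 * (4 / 5) ^ n) = 4 * ((n : ℝ) ^ 3 * (4 / 5) ^ n) * (n : ℝ) ^ (-1 : ℝ) := by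
        rw [rpow_neg_one]
        field_simp
    _ ≤ 1 * (n : ℝ) ^ (-1 : ℝ) := by
        gcongr
        linarith
    _ ≤ _ := by
        rw [one_mul]
        exact rpow_le_rpow_of_exponent_le hn1 (by norm_num)

/-- In the stated range `k` is logarithmic in `n`, so polynomial factors in `k` are negligible. -/
lemma poly_le_exp {n k i : ℕ} {C : ℝ} (hm : 10000000 ≤ log n)
    (he : log 5 + (2 * (C * log (log n)) + 4) * log (4 * log n) ≤ log n / 8000)
    (hi : (i : ℝ) ≤ C * log (log n)) (hκ : k * log 2 ≤ 2 * log n) :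
    5 * ((k : ℝ) + 1) ^ (2 * i + 4) ≤ exp (log n / 8000) := by
  have hk0 : (0 : ℝ) ≤ k := Nat.cast_nonneg k
  have hk : (k : ℝ) + 1 ≤ 4 * log n := by
    have := log_two_gt_d9
    nlinarith
  have h1 : log (5 * ((k : ℝ) + 1) ^ (2 * i + 4)) ≤ log n / 8000 := by
    rw [log_mul (by norm_num) (by positivity), log_pow]
    refine le_trans ?_ he
    have h2 : log ((k : ℝ) + 1) ≤ log (4 * log n) := log_le_log (by positivity) hk
    have h3 : 0 ≤ log ((k : ℝ) + 1) := log_nonneg (by linarith)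
    push_cast
    gcongr
    linarith
  calc _ = exp (log (5 * ((k : ℝ) + 1) ^ (2 * i + 4))) := (exp_log (by positivity)).symm
    _ ≤ _ := exp_le_exp.2 h1

end Main

theorem stmt10 (C : ℝ) (hC : 0 < C) :
    ∃ N : ℕ, ∀ n : ℕ, N ≤ n → ∀ k i : ℕ,
      (n : ℝ) ^ (5 / 6 : ℝ) ≤ expY n k → expY n k ≤ (n : ℝ) ^ (6 / 5 : ℝ) →
      (i : ℝ) ≤ C * Real.log (Real.log n) →
      grPr n {G | ∃ S : Finset (Fin n), S.card = k + 1 ∧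
          (edgesIn G S = i ∨ edgesIn G S = i + 1) ∧
          ∃ u ∈ S, ∃ v ∈ S, G.Adj u v ∧
            (numCovers n k G u v : ℝ) ≤ (3 / 4 : ℝ) ^ k * expY n k / 2}
        ≤ (n : ℝ) ^ (-(1 / 100) : ℝ) ∧
      grPr n {G | ∃ S : Finset (Fin n), S.card = k + 1 ∧
          (edgesIn G S = i ∨ edgesIn G S = i + 1) ∧
          ∃ u ∈ S, ∃ v ∈ S, G.Adj u v ∧
            ∃ T₁ T₂ : Finset (Fin n), T₁ ≠ T₂ ∧ (T₁ ∩ T₂).Nonempty ∧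
              T₁.card = k ∧ edgesIn G T₁ = 0 ∧ Covers G T₁ u v ∧
              T₂.card = k ∧ edgesIn G T₂ = 0 ∧ Covers G T₂ u v}
        ≤ (n : ℝ) ^ (-(1 / 100) : ℝ) := by
  have hlog : Filter.Tendsto (fun n : ℕ => Real.log n) Filter.atTop Filter.atTop :=
    Real.tendsto_log_atTop.comp tendsto_natCast_atTop_atTop
  obtain ⟨N, hN⟩ := Filter.eventually_atTop.1
    ((hlog.eventually (eventually_log_pow_bound C hC)).and
      ((hlog.eventually_ge_atTop 10000000).and eventually_geometric_bound))
  refine ⟨N, fun n hNn k i hX1 hX2 hi => ?_⟩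
  obtain ⟨he, hm, hg⟩ := hN n hNn
  have hn0 : 0 < n := by
    rcases Nat.eq_zero_or_pos n with rfl | h
    · norm_num at hm
    · exact h
  have hn1 : (1 : ℝ) ≤ n := by exact_mod_cast hn0
  have hX : 0 < expY n k := lt_of_lt_of_le (Real.rpow_pos_of_pos (by linarith) _) hX1
  have hkn : k ≤ n := by
    by_contra! h
    simp [expY, Nat.choose_eq_zero_of_lt h] at hX
  have hlX1 := Real.log_le_log (Real.rpow_pos_of_pos (by linarith) _) hX1
  have hlX2 := Real.log_le_log hX hX2
  rw [Real.log_rpow (by linarith)] at hlX1 hlX2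
  obtain rfl | rfl | hk : k = 0 ∨ k = 1 ∨ 2 ≤ k := by omega
  · simp only [expY, Nat.choose_zero_right, Nat.choose_zero_succ, pow_zero, Nat.cast_one, div_one,
      Real.log_one] at hlX1
    linarith
  · refine ⟨(grPr_few_vertices_cover_le fun G S => edgesIn G S = i ∨ edgesIn G S = i + 1).trans hg,
      ?_⟩
    rw [grPr_overlapping_vertices_cover_eq_zero fun G S => edgesIn G S = i ∨ edgesIn G S = i + 1]
    positivity
  · have hκ2 := mul_log_two_le hk hkn (by linarith)
    have hQ := poly_le_exp hm he hi hκ2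
    have hk1 : (1 : ℝ) ≤ (k : ℝ) + 1 := by linarith [Nat.cast_nonneg (α := ℝ) k]
    have hQ' : 5 * ((k : ℝ) + 1) ^ 2 ≤ Real.exp (Real.log n / 8000) := by
      refine le_trans ?_ hQ
      gcongr
      omega
    have hexp : Real.exp (Real.log n / 8000) ≤ n := by
      rw [← Real.le_log_iff_exp_le (by linarith)]
      linarith
    have h2k : Real.log (2 * k) ≤ Real.log n / 8000 := by
      rw [Real.log_le_iff_le_exp (by positivity)]
      nlinarith
    have hkn2 : 4 * ((k + 1) * k) ≤ n := by
      have : (4 * ((k + 1) * k) : ℝ) ≤ n := by nlinarith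
      exact_mod_cast this
    have hκ1 := le_mul_log_two hk (by nlinarith) hm h2k hlX2
    obtain ⟨R, hR0, hR, hB2, hB3⟩ := event_bounds hn0 hk hm hQ hX hlX1 hlX2 hκ1 hκ2
    exact ⟨(grPr_few_covers_le (by omega) hR0 hR (three_quarters_choose_le (by omega) hkn2)
      (Nat.choose_pos hkn)).trans hB2, (grPr_overlapping_covers_le (by omega) hR0 hR).trans hB3⟩
end

section
/- For every C > 0 and every ε > 0 there exist ε₀ > 0 and N such that the following holds for all n ≥ N. Let k be an integer with |k − 2·log₂ n| ≤ C·log log n, let r be an integer with 1 ≤ r ≤ ε₀·(log log n)/(log log log n), and let j ∈ {1, …, r} be such that E[Z_{k+1,μ_j}] ≤ log n. Then the probability that some (k+1)-element vertex subset of G_{n,1/2} induces strictly fewer than μ_j edges is at most (log n)^{−1+ε}. -/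
open scoped Classical

/-- `E[Z_{k,i}] = C(n,k)·C(C(k,2),i)·2^{-C(k,2)}`. -/
noncomputable def expZ (n k i : ℕ) : ℝ :=
  (n.choose k : ℝ) * ((k.choose 2).choose i : ℝ) / 2 ^ (k.choose 2)

/-- `μ_j = ⌊(r - j)/j⌋`. -/
def muD (r j : ℕ) : ℕ := (r - j) / j

/-- The potential edges with both endpoints in `s`. -/
noncomputable def potentialEdges {n : ℕ} (s : Finset (Fin n)) : Finset (Sym2 (Fin n)) :=
  s.offDiag.image Sym2.mk.uncurry

theorem mem_potentialEdges {n : ℕ} {s : Finset (Fin n)} {e : Sym2 (Fin n)} :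
    e ∈ potentialEdges s ↔ ¬ e.IsDiag ∧ ∀ v ∈ e, v ∈ s := by
  induction e with
  | _ a b =>
    simp only [potentialEdges, Finset.mem_image, Finset.mem_offDiag, Prod.exists,
      Sym2.mk_isDiag_iff, Sym2.mem_iff, forall_eq_or_imp, forall_eq]
    constructor
    · rintro ⟨x, y, ⟨hx, hy, hxy⟩, h⟩
      rcases Sym2.eq_iff.1 h with ⟨rfl, rfl⟩ | ⟨rfl, rfl⟩
      · exact ⟨hxy, hx, hy⟩
      · exact ⟨fun h => hxy h.symm, hy, hx⟩
    · rintro ⟨hab, ha, hb⟩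
      exact ⟨a, b, ⟨ha, hb, hab⟩, rfl⟩

theorem card_potentialEdges {n : ℕ} (s : Finset (Fin n)) :
    (potentialEdges s).card = s.card.choose 2 :=
  Sym2.card_image_offDiag s

theorem edgesIn_eq_card {n : ℕ} (G : SimpleGraph (Fin n)) (s : Finset (Fin n)) :
    edgesIn G s = (G.edgeFinset ∩ potentialEdges s).card := by
  rw [edgesIn, ← Set.ncard_coe_finset]
  congr 1
  ext e
  simp only [Set.mem_ofPred_eq, Finset.coe_inter, Set.mem_inter_iff, Finset.mem_coe,
    SimpleGraph.mem_edgeFinset, mem_potentialEdges]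
  exact ⟨fun h => ⟨h.1, G.not_isDiag_of_mem_edgeSet h.1, h.2⟩, fun h => ⟨h.1, h.2.2⟩⟩

theorem two_pow_card_potentialEdges_univ_le (n : ℕ) :
    2 ^ (potentialEdges (Finset.univ : Finset (Fin n))).card ≤
      Fintype.card (SimpleGraph (Fin n)) := by
  rw [← Finset.card_powerset, ← Finset.card_univ]
  refine Finset.card_le_card_of_injOn (fun A => SimpleGraph.fromEdgeSet (A : Set (Sym2 (Fin n))))
    (fun _ _ => Finset.mem_coe.2 (Finset.mem_univ _)) ?_
  intro A hA B hB hAB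
  have hdiff : ∀ D : Finset (Sym2 (Fin n)), D ⊆ potentialEdges Finset.univ →
      (SimpleGraph.fromEdgeSet (D : Set (Sym2 (Fin n)))).edgeSet = D := by
    intro D hD
    rw [SimpleGraph.edgeSet_fromEdgeSet]
    ext e
    simp only [Set.mem_sdiff, Finset.mem_coe]
    exact ⟨fun h => h.1, fun h => ⟨h, (mem_potentialEdges.1 (hD h)).1⟩⟩
  have h := congrArg SimpleGraph.edgeSet hAB
  simp only [Finset.coe_powerset, Set.mem_preimage, Set.mem_powerset_iff,
    Finset.coe_subset] at hA hB
  rw [hdiff A hA, hdiff B hB] at h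
  exact_mod_cast h

theorem card_edgesIn_lt_mul_le {n : ℕ} (s : Finset (Fin n)) (m : ℕ) :
    (Finset.univ.filter fun G : SimpleGraph (Fin n) => edgesIn G s < m).card *
        2 ^ (s.card.choose 2) ≤
      (∑ i ∈ Finset.range m, (s.card.choose 2).choose i) *
        Fintype.card (SimpleGraph (Fin n)) := by
  set E := potentialEdges (Finset.univ : Finset (Fin n))
  set P := potentialEdges s with hP
  have hPE : P ⊆ E := fun e he =>
    mem_potentialEdges.2 ⟨(mem_potentialEdges.1 he).1, fun v _ => Finset.mem_univ v⟩
  have hcount : (Finset.univ.filter fun G : SimpleGraph (Fin n) => edgesIn G s < m).card ≤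
      (((Finset.range m).biUnion fun i => P.powersetCard i) ×ˢ (E \ P).powerset).card := by
    refine Finset.card_le_card_of_injOn
      (fun G => (G.edgeFinset ∩ P, G.edgeFinset \ P)) ?_ ?_
    · intro G hG
      have hG' : edgesIn G s < m := by simpa using hG
      rw [edgesIn_eq_card] at hG'
      simp only [Finset.mem_coe, Finset.mem_product, Finset.mem_biUnion, Finset.mem_range,
        Finset.mem_powersetCard, Finset.mem_powerset]
      refine ⟨⟨_, hG', Finset.inter_subset_right, rfl⟩, Finset.sdiff_subset_sdiff ?_ le_rfl⟩
      intro e he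
      exact mem_potentialEdges.2
        ⟨G.not_isDiag_of_mem_edgeSet (SimpleGraph.mem_edgeFinset.1 he),
          fun v _ => Finset.mem_univ v⟩
    · intro G _ H _ hGH
      simp only [Prod.mk.injEq] at hGH
      rw [← SimpleGraph.edgeFinset_inj]
      rw [← Finset.sdiff_union_inter G.edgeFinset P, ← Finset.sdiff_union_inter H.edgeFinset P,
        hGH.1, hGH.2]
  have hbi : ((Finset.range m).biUnion fun i => P.powersetCard i).card ≤
      ∑ i ∈ Finset.range m, (s.card.choose 2).choose i := by
    refine Finset.card_biUnion_le.trans (le_of_eq ?_)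
    simp [hP, card_potentialEdges]
  rw [Finset.card_product, Finset.card_powerset] at hcount
  calc _ ≤ (∑ i ∈ Finset.range m, (s.card.choose 2).choose i) * 2 ^ (E \ P).card *
        2 ^ (s.card.choose 2) :=
        Nat.mul_le_mul_right _ (hcount.trans (Nat.mul_le_mul_right _ hbi))
    _ = (∑ i ∈ Finset.range m, (s.card.choose 2).choose i) * 2 ^ E.card := by
        rw [mul_assoc, ← pow_add, ← card_potentialEdges s, Finset.card_sdiff_add_card_eq_card hPE]
    _ ≤ _ := Nat.mul_le_mul_left _ (two_pow_card_potentialEdges_univ_le n)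

theorem grPr_eq_card_div (n : ℕ) (S : Set (SimpleGraph (Fin n))) :
    grPr n S = ((Finset.univ.filter fun G => G ∈ S).card : ℝ) /
      Fintype.card (SimpleGraph (Fin n)) := by
  rw [grPr, PMF.toOuterMeasure_uniformOfFintype_apply, ENNReal.toReal_div]
  simp only [ENNReal.toReal_natCast]
  rw [Fintype.card_subtype]

theorem grPr_exists_edgesIn_lt_le (n K m : ℕ) :
    grPr n {G | ∃ S : Finset (Fin n), S.card = K ∧ edgesIn G S < m} ≤
      ∑ i ∈ Finset.range m, expZ n K i := by
  have hpos : (0 : ℝ) < Fintype.card (SimpleGraph (Fin n)) := by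
    exact_mod_cast Fintype.card_pos
  rw [grPr_eq_card_div, div_le_iff₀ hpos]
  have hsub : (Finset.univ.filter fun G : SimpleGraph (Fin n) =>
      G ∈ {G | ∃ S : Finset (Fin n), S.card = K ∧ edgesIn G S < m}) ⊆
      ((Finset.univ : Finset (Fin n)).powersetCard K).biUnion
        fun S => Finset.univ.filter fun G => edgesIn G S < m := by
    intro G hG
    obtain ⟨S, hS, hlt⟩ : ∃ S : Finset (Fin n), S.card = K ∧ edgesIn G S < m := by
      simpa using hG
    simp only [Finset.mem_biUnion, Finset.mem_filter, Finset.mem_univ, true_and]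
    exact ⟨S, Finset.mem_powersetCard.2 ⟨Finset.subset_univ _, hS⟩, hlt⟩
  have hcard := (Finset.card_le_card hsub).trans Finset.card_biUnion_le
  have hterm : ∀ S ∈ (Finset.univ : Finset (Fin n)).powersetCard K,
      ((Finset.univ.filter fun G : SimpleGraph (Fin n) => edgesIn G S < m).card : ℝ) ≤
        (∑ i ∈ Finset.range m, ((K.choose 2).choose i : ℝ)) *
          Fintype.card (SimpleGraph (Fin n)) / 2 ^ (K.choose 2) := by
    intro S hS
    rw [le_div_iff₀ (by positivity)]
    have h := card_edgesIn_lt_mul_le S m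
    rw [(Finset.mem_powersetCard.1 hS).2] at h
    exact_mod_cast h
  calc _ ≤ ∑ S ∈ (Finset.univ : Finset (Fin n)).powersetCard K,
        ((Finset.univ.filter fun G : SimpleGraph (Fin n) => edgesIn G S < m).card : ℝ) := by
        have h := (Nat.cast_le (α := ℝ)).2 hcard
        rw [Nat.cast_sum] at h
        convert h using 1 <;> congr!
    _ ≤ _ := Finset.sum_le_sum hterm
    _ = _ := by
        simp only [Finset.sum_const, Finset.card_powersetCard, Finset.card_univ, Fintype.card_fin,
          nsmul_eq_mul, expZ, ← Finset.sum_div, ← Finset.mul_sum]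
        ring

theorem choose_mul_sub_le {M m i : ℕ} (hm : 2 * m ≤ M) (hi : i < m) :
    M.choose i * (M - m) ≤ m * M.choose m := by
  induction m, hi using Nat.le_induction with
  | base =>
    have h := Nat.choose_succ_right_eq M i
    calc M.choose i * (M - (i + 1)) ≤ M.choose i * (M - i) := Nat.mul_le_mul_left _ (by omega)
      _ = _ := by rw [← h, mul_comm]
  | succ m hle ih =>
    have h := Nat.choose_succ_right_eq M m
    calc M.choose i * (M - (m + 1)) ≤ M.choose i * (M - m) := Nat.mul_le_mul_left _ (by omega)
      _ ≤ m * M.choose m := ih (by omega)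
      _ ≤ (M - m) * M.choose m := Nat.mul_le_mul_right _ (by omega)
      _ = _ := by rw [mul_comm, ← h, mul_comm]

theorem sum_expZ_mul_le {n K m : ℕ} (hm : 2 * m ≤ K.choose 2) :
    (∑ i ∈ Finset.range m, expZ n K i) * ((K.choose 2 : ℝ) - m) ≤ (m : ℝ) ^ 2 * expZ n K m := by
  have hterm : ∀ i ∈ Finset.range m,
      expZ n K i * ((K.choose 2 : ℝ) - m) ≤ m * expZ n K m := by
    intro i hi
    have h := choose_mul_sub_le hm (Finset.mem_range.1 hi)
    have h' : ((K.choose 2).choose i : ℝ) * ((K.choose 2 : ℝ) - m) ≤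
        m * (K.choose 2).choose m := by
      rw [← Nat.cast_sub (by omega)]
      exact_mod_cast h
    calc _ = (n.choose K : ℝ) / 2 ^ (K.choose 2) *
          (((K.choose 2).choose i : ℝ) * ((K.choose 2 : ℝ) - m)) := by rw [expZ]; ring
      _ ≤ (n.choose K : ℝ) / 2 ^ (K.choose 2) * (m * (K.choose 2).choose m) := by gcongr
      _ = _ := by rw [expZ]; ring
  rw [Finset.sum_mul]
  refine (Finset.sum_le_sum hterm).trans (le_of_eq ?_)
  simp only [Finset.sum_const, Finset.card_range, nsmul_eq_mul]
  ring

theorem stmt12 (C ε : ℝ) (hC : 0 < C) (hε : 0 < ε) :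
    ∃ ε₀ : ℝ, 0 < ε₀ ∧ ∃ N : ℕ, ∀ n : ℕ, N ≤ n → ∀ k r j : ℕ,
      |(k : ℝ) - 2 * Real.logb 2 n| ≤ C * Real.log (Real.log n) →
      1 ≤ r →
      (r : ℝ) ≤ ε₀ * Real.log (Real.log n) / Real.log (Real.log (Real.log n)) →
      1 ≤ j → j ≤ r →
      expZ n (k + 1) (muD r j) ≤ Real.log n →
      grPr n {G | ∃ S : Finset (Fin n), S.card = k + 1 ∧ edgesIn G S < muD r j} ≤
        (Real.log n) ^ (-1 + ε) := by
  have hL : Filter.Tendsto (fun n : ℕ => Real.log n) Filter.atTop Filter.atTop :=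
    Real.tendsto_log_atTop.comp tendsto_natCast_atTop_atTop
  have hLLL : Filter.Tendsto (fun x : ℝ => Real.log (Real.log x)) Filter.atTop Filter.atTop :=
    Real.tendsto_log_atTop.comp Real.tendsto_log_atTop
  have hlog : ∀ᶠ x : ℝ in Filter.atTop, Real.log x ≤ x ^ (ε / 2) := by
    filter_upwards [(isLittleO_log_rpow_atTop (half_pos hε)).bound one_pos,
      Filter.eventually_ge_atTop 1] with x hx h1
    rw [Real.norm_of_nonneg (Real.log_nonneg h1),
      Real.norm_of_nonneg (Real.rpow_nonneg (by linarith) _), one_mul] at hx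
    exact hx
  have hlin : ∀ᶠ x : ℝ in Filter.atTop, Real.log x ≤ min 1 (1 / (2 * C)) * x := by
    filter_upwards [Real.isLittleO_log_id_atTop.bound
      (lt_min one_pos (by positivity : 0 < 1 / (2 * C))),
      Filter.eventually_ge_atTop 1] with x hx h1
    rw [Real.norm_of_nonneg (Real.log_nonneg h1),
      Real.norm_of_nonneg (by simp only [id]; linarith)] at hx
    exact hx
  have hev := hL.eventually
    (hlog.and (hlin.and ((hLLL.eventually_ge_atTop 1).and (Filter.eventually_ge_atTop 2))))
  obtain ⟨N, hN⟩ := Filter.eventually_atTop.1 hev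
  refine ⟨1, one_pos, N, fun n hn k r j hk _ hr _ _ hexp => ?_⟩
  obtain ⟨hlogL, hlinL, hLL, hL2⟩ := hN n hn
  set L := Real.log n with hLdef
  set m := muD r j with hm
  have hlogL0 : 0 ≤ Real.log L := Real.log_nonneg (by linarith)
  have hmr : (m : ℝ) ≤ r := by
    exact_mod_cast (Nat.div_le_self _ _).trans (Nat.sub_le r j)
  have hmlog : (m : ℝ) ≤ Real.log L := by
    rw [one_mul] at hr
    exact hmr.trans (hr.trans (div_le_self hlogL0 hLL))
  have hlogle : Real.log L ≤ L :=
    hlinL.trans (mul_le_of_le_one_left (by linarith) (min_le_left _ _))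
  have hClog : C * Real.log L ≤ L / 2 := by
    have h : Real.log L ≤ 1 / (2 * C) * L :=
      hlinL.trans (mul_le_mul_of_nonneg_right (min_le_right _ _) (by linarith))
    calc C * Real.log L ≤ C * (1 / (2 * C) * L) := by gcongr
      _ = L / 2 := by field_simp
  have hlogb : 5 / 4 * L ≤ Real.logb 2 n := by
    rw [Real.logb, le_div_iff₀ (Real.log_pos one_lt_two), ← hLdef]
    nlinarith [Real.log_two_lt_d9]
  have hk2 : 2 * L ≤ k := by linarith [(abs_le.1 hk).1]
  have hM : 2 * L ^ 2 + L ≤ ((k + 1).choose 2 : ℝ) := by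
    rw [Nat.cast_choose_two]
    push_cast
    nlinarith
  have h2m : 2 * m ≤ (k + 1).choose 2 := by
    have : (2 * m : ℝ) ≤ ((k + 1).choose 2 : ℝ) := by nlinarith
    exact_mod_cast this
  have hsum := sum_expZ_mul_le (n := n) h2m
  have hden : L ^ 2 ≤ ((k + 1).choose 2 : ℝ) - m := by nlinarith
  have hm2 : (m : ℝ) ^ 2 ≤ L ^ ε := by
    calc (m : ℝ) ^ 2 ≤ (L ^ (ε / 2)) ^ 2 := by
          gcongr
          exact hmlog.trans hlogL
      _ = L ^ ε := by
          rw [← Real.rpow_natCast, ← Real.rpow_mul (by linarith)]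
          congr 1
          push_cast
          ring
  refine (grPr_exists_edgesIn_lt_le n (k + 1) m).trans ?_
  have hnonneg : 0 ≤ ∑ i ∈ Finset.range m, expZ n (k + 1) i :=
    Finset.sum_nonneg fun i _ => by rw [expZ]; positivity
  have hL0 : 0 < L := by linarith
  have hkey : (∑ i ∈ Finset.range m, expZ n (k + 1) i) * L ^ 2 ≤ L ^ ε * L :=
    calc _ ≤ (∑ i ∈ Finset.range m, expZ n (k + 1) i) * (((k + 1).choose 2 : ℝ) - m) := by gcongr
      _ ≤ (m : ℝ) ^ 2 * expZ n (k + 1) m := hsum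
      _ ≤ (m : ℝ) ^ 2 * L := by gcongr
      _ ≤ L ^ ε * L := by gcongr
  rw [Real.rpow_add hL0, Real.rpow_neg_one, inv_mul_eq_div, le_div_iff₀ hL0]
  refine le_of_mul_le_mul_right ?_ hL0
  linarith
end
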